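/- arXiv:1412.4840 — 2 statements merged into one kernel-verified Lean document; each statement's English description precedes it below -/
import Mathlib

section
/- For every n ≥ 2 there exist a dynamic (U,V) for the n×n identity matrix I_n and real constants C ≥ c > 0 such that for every step t ≥ 1, c·t^((n−1)/n) ≤ gap(t) ≤ C·t^((n−1)/n). Consequently this execution of fictitious play converges at rate Θ(t^(−1/n)): the normalized duality gap gap(t)/t is bounded above and below by constant multiples of t^(−1/n). -/
/-- A dynamic for the `n × n` identity matrix `Iₙ`: sequences `U V : ℕ → Fin n → ℕ`
starting at the zero vectors such that at each step `t` there are indices `i`, `j`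
with `V i t` maximal in `V t` and `U j t` minimal in `U t`, and `U` is incremented
by `e_i` while `V` is incremented by `e_j`. -/
def IsDynamic (n : ℕ) (U V : ℕ → Fin n → ℕ) : Prop :=
  (∀ l, U 0 l = 0) ∧ (∀ l, V 0 l = 0) ∧
  ∀ t, ∃ i j : Fin n,
    (∀ l, V t l ≤ V t i) ∧ (∀ l, U t j ≤ U t l) ∧
    (∀ l, U (t + 1) l = U t l + if l = i then 1 else 0) ∧
    (∀ l, V (t + 1) l = V t l + if l = j then 1 else 0)

/-- The duality gap of a dynamic at step `t`: `max_l V l t − min_l U l t`. -/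
noncomputable def gap (n : ℕ) (U V : ℕ → Fin n → ℕ) (t : ℕ) : ℤ :=
  ((⨆ l, V t l : ℕ) : ℤ) - ((⨅ l, U t l : ℕ) : ℤ)

/-- One step of fictitious play on the identity matrix, on states `(U, V)`. -/
def FPStep {n : ℕ} (s s' : (Fin n → ℕ) × (Fin n → ℕ)) : Prop :=
  ∃ i j : Fin n,
    (∀ l, s.2 l ≤ s.2 i) ∧ (∀ l, s.1 j ≤ s.1 l) ∧
    (∀ l, s'.1 l = s.1 l + if l = i then 1 else 0) ∧
    (∀ l, s'.2 l = s.2 l + if l = j then 1 else 0)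

/-- Reachability by finitely many steps of fictitious play. -/
abbrev FPReach {n : ℕ} : (Fin n → ℕ) × (Fin n → ℕ) → (Fin n → ℕ) × (Fin n → ℕ) → Prop :=
  Relation.ReflTransGen FPStep

namespace FPStep

variable {n : ℕ} {s s' : (Fin n → ℕ) × (Fin n → ℕ)}

lemma fst_le (h : FPStep s s') (l : Fin n) : s.1 l ≤ s'.1 l := by
  obtain ⟨i, j, -, -, h1, -⟩ := h
  rw [h1]; omega

lemma snd_le (h : FPStep s s') (l : Fin n) : s.2 l ≤ s'.2 l := by
  obtain ⟨i, j, -, -, -, h2⟩ := h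
  rw [h2]; omega

lemma sum_fst (h : FPStep s s') : ∑ l, s'.1 l = ∑ l, s.1 l + 1 := by
  obtain ⟨i, j, -, -, h1, -⟩ := h
  simp [h1, Finset.sum_add_distrib]

lemma sum_snd (h : FPStep s s') : ∑ l, s'.2 l = ∑ l, s.2 l + 1 := by
  obtain ⟨i, j, -, -, -, h2⟩ := h
  simp [h2, Finset.sum_add_distrib]

/-- Adding constants to both coordinates of a state preserves steps. -/
lemma translate (h : FPStep s s') (x y : ℕ) :
    FPStep (fun l => x + s.1 l, fun l => y + s.2 l) (fun l => x + s'.1 l, fun l => y + s'.2 l) := by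
  obtain ⟨i, j, hi, hj, h1, h2⟩ := h
  refine ⟨i, j, fun l => ?_, fun l => ?_, fun l => ?_, fun l => ?_⟩
  · simpa using hi l
  · simpa using hj l
  · simp only [h1, add_assoc]
  · simp only [h2, add_assoc]

lemma perm (h : FPStep s s') (σ : Equiv.Perm (Fin n)) :
    FPStep (fun l => s.1 (σ l), fun l => s.2 (σ l)) (fun l => s'.1 (σ l), fun l => s'.2 (σ l)) := by
  obtain ⟨i, j, hi, hj, h1, h2⟩ := h
  refine ⟨σ.symm i, σ.symm j, fun l => ?_, fun l => ?_, fun l => ?_, fun l => ?_⟩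
  · simpa using hi (σ l)
  · simpa using hj (σ l)
  · simp [h1, Equiv.eq_symm_apply]
  · simp [h2, Equiv.eq_symm_apply]

/-- A step survives the insertion of a new coordinate `p` that is not the unique minimum of `U`
nor the unique maximum of `V`. -/
lemma insertNth (h : FPStep s s') (p : Fin (n + 1)) {a b : ℕ}
    (ha : ∃ l, s.1 l ≤ a) (hb : ∃ l, b ≤ s.2 l) :
    FPStep (n := n + 1) (p.insertNth a s.1, p.insertNth b s.2)
      (p.insertNth a s'.1, p.insertNth b s'.2) := by
  obtain ⟨i, j, hi, hj, h1, h2⟩ := h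
  obtain ⟨la, ha⟩ := ha
  obtain ⟨lb, hb⟩ := hb
  refine ⟨p.succAbove i, p.succAbove j, ?_, ?_, ?_, ?_⟩ <;>
    simp only [Fin.forall_iff_succAbove p, Fin.insertNth_apply_same,
      Fin.insertNth_apply_succAbove, Fin.succAbove_right_inj]
  · exact ⟨hb.trans (hi _), hi⟩
  · exact ⟨(hj _).trans ha, hj⟩
  · exact ⟨by simp [(Fin.succAbove_ne p i).symm], h1⟩
  · exact ⟨by simp [(Fin.succAbove_ne p j).symm], h2⟩

end FPStep

namespace FPReach

variable {n : ℕ} {s s' : (Fin n → ℕ) × (Fin n → ℕ)}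

lemma fst_le (h : FPReach s s') (l : Fin n) : s.1 l ≤ s'.1 l := by
  induction h with
  | refl => exact le_rfl
  | tail _ h ih => exact ih.trans (h.fst_le l)

lemma sum_add_sum (h : FPReach s s') :
    ∑ l, s'.2 l + ∑ l, s.1 l = ∑ l, s.2 l + ∑ l, s'.1 l := by
  induction h with
  | refl => rfl
  | tail _ h ih => rw [h.sum_fst, h.sum_snd]; omega

lemma translate (h : FPReach s s') (x y : ℕ) :
    FPReach (fun l => x + s.1 l, fun l => y + s.2 l) (fun l => x + s'.1 l, fun l => y + s'.2 l) := by
  induction h with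
  | refl => exact .refl
  | tail _ h ih => exact ih.tail (h.translate x y)

lemma perm (h : FPReach s s') (σ : Equiv.Perm (Fin n)) :
    FPReach (fun l => s.1 (σ l), fun l => s.2 (σ l)) (fun l => s'.1 (σ l), fun l => s'.2 (σ l)) := by
  induction h with
  | refl => exact .refl
  | tail _ h ih => exact ih.tail (h.perm σ)

lemma insertNth (h : FPReach s s') (p : Fin (n + 1)) {a b : ℕ}
    (ha : ∃ l, s'.1 l ≤ a) (hb : ∃ l, b ≤ s.2 l) :
    FPReach (n := n + 1) (p.insertNth a s.1, p.insertNth b s.2)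
      (p.insertNth a s'.1, p.insertNth b s'.2) := by
  induction h using Relation.ReflTransGen.head_induction_on with
  | refl => exact .refl
  | head h h' ih =>
    obtain ⟨la, ha⟩ := ha
    obtain ⟨lb, hb⟩ := hb
    exact .head (h.insertNth p ⟨la, (fst_le (.head h h') la).trans ha⟩ ⟨lb, hb⟩)
      (ih ⟨lb, hb.trans (h.snd_le lb)⟩)

/-- While `k` maximizes `V` and every other coordinate minimizes `U`, the other coordinates of `V`
can be raised at will up to `V k`. -/
lemma fill (k : Fin n) (A : ℕ) (V W : Fin n → ℕ) (hVW : ∀ l, V l ≤ W l) (hW : ∀ l, W l ≤ V k) :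
    ∀ x, FPReach (fun l => A + if l = k then x else 0, V)
      (fun l => A + if l = k then x + (∑ l, W l - ∑ l, V l) else 0, W) := by
  have hs : ∑ l, V l ≤ ∑ l, W l := Finset.sum_le_sum fun l _ => hVW l
  obtain ⟨d, hd⟩ := Nat.exists_eq_add_of_le hs
  induction d generalizing V with
  | zero =>
    intro x
    have : V = W := by
      funext l
      exact (Finset.sum_eq_sum_iff_of_le fun l _ => hVW l).1 (by omega) l (Finset.mem_univ l)
    subst this
    simpa using Relation.ReflTransGen.refl
  | succ d ih =>
    intro x
    obtain ⟨j, -, hj⟩ : ∃ j ∈ Finset.univ, V j < W j :=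
      Finset.exists_lt_of_sum_lt (by omega)
    have hjk : j ≠ k := by
      rintro rfl
      exact absurd (hW j) (by omega)
    have hsum : ∑ l, (V l + if l = j then 1 else 0) = ∑ l, V l + 1 := by
      simp [Finset.sum_add_distrib]
    have key := ih (fun l => V l + if l = j then 1 else 0) (fun l => ?_) (fun l => ?_)
      (by rw [hsum]; omega) (by rw [hsum]; omega) (x + 1)
    · rw [hsum] at key
      have e : x + 1 + (∑ l, W l - (∑ l, V l + 1)) = x + (∑ l, W l - ∑ l, V l) := by omega
      rw [e] at key
      refine .head ⟨k, j, fun l => (hVW l).trans (hW l), fun l => ?_, fun l => ?_, fun l => rfl⟩ key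
      · simp [hjk]
      · by_cases h : l = k <;> simp [h, add_assoc]
    · have := hVW l
      by_cases h : l = j
      · subst h; simpa using hj
      · simpa [h] using this
    · have := hW l
      simp [hjk.symm, this]

/-- One balanced round of play: every coordinate of `U` and the maximum of `V` grow by one. -/
lemma balanced_round (n : ℕ) (k : Fin (n + 1)) :
    ∃ k', FPReach (fun _ => 0, fun l => if l = k then 1 else 0)
      (fun _ => 1, fun l => 1 + if l = k' then 1 else 0) := by
  induction n with
  | zero =>
    refine ⟨k, .single ⟨k, k, ?_, ?_, ?_, ?_⟩⟩ <;> intro l <;> simp [Fin.eq_zero l, Fin.eq_zero k]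
  | succ n ih =>
    obtain ⟨k', hk'⟩ := ih 0
    have h := hk'.insertNth k (a := 1) (b := 1) ⟨0, le_rfl⟩ ⟨0, by simp⟩
    have e₁ : ((k.insertNth 1 fun _ => 1, k.insertNth 1 fun l => 1 + if l = k' then 1 else 0) :
        (Fin (n + 1 + 1) → ℕ) × (Fin (n + 1 + 1) → ℕ)) =
        (fun _ => 1, fun l => 1 + if l = k.succAbove k' then 1 else 0) := by
      ext l <;> cases l using k.succAboveCases <;> simp [(Fin.succAbove_ne _ _).symm]
    rw [e₁] at h
    refine ⟨k.succAbove k', .head ⟨k, k.succAbove 0, ?_, ?_, ?_, ?_⟩ h⟩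
    · intro l; by_cases hl : l = k <;> simp [hl]
    · intro l; simp
    · simp [Fin.forall_iff_succAbove k, Fin.succAbove_ne]
    · simp [Fin.forall_iff_succAbove k, Fin.succAbove_ne, (Fin.succAbove_ne _ _).symm]

/-- Starting from `V = e_k`, the game can be played for `x` rounds without enlarging the gap. -/
lemma balanced (n : ℕ) (k : Fin (n + 1)) (x : ℕ) :
    ∃ k', FPReach (fun _ => 0, fun l => if l = k then 1 else 0)
      (fun _ => x, fun l => x + if l = k' then 1 else 0) := by
  induction x with
  | zero => exact ⟨k, by simpa using Relation.ReflTransGen.refl⟩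
  | succ x ih =>
    obtain ⟨k₁, h₁⟩ := ih
    obtain ⟨k₂, h₂⟩ := balanced_round n k₁
    refine ⟨k₂, h₁.trans ?_⟩
    simpa [add_assoc] using h₂.translate x x

end FPReach

lemma exists_seq_of_step {β : Type*} (P : ℕ → β → Prop) (R : β → β → Prop) (b : β) (hb : P 0 b)
    (hs : ∀ m b, P m b → ∃ b', P (m + 1) b' ∧ R b b') :
    ∃ f : ℕ → β, f 0 = b ∧ (∀ m, P m (f m)) ∧ ∀ m, R (f m) (f (m + 1)) := by
  choose! g hg using hs
  let f : ℕ → β := fun m => Nat.rec b (fun m x => g m x) m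
  have hf : ∀ m, P m (f m) := fun m => by
    induction m with
    | zero => exact hb
    | succ m ih => exact (hg m _ ih).1
  exact ⟨f, rfl, hf, fun m => (hg m _ (hf m)).2⟩

lemma exists_path_extension {β : Type*} {r : β → β → Prop} {x y : β} (h : Relation.TransGen r x y)
    (T : ℕ) (σ : ℕ → β) (hT : σ T = x) (hσ : ∀ t < T, r (σ t) (σ (t + 1))) :
    ∃ (T' : ℕ) (σ' : ℕ → β), T < T' ∧ (∀ t ≤ T, σ' t = σ t) ∧ σ' T' = y ∧
      ∀ t < T', r (σ' t) (σ' (t + 1)) := by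
  have aux : ∀ (T : ℕ) (σ : ℕ → β) (z : β), (∀ t < T, r (σ t) (σ (t + 1))) → r (σ T) z →
      ∃ σ' : ℕ → β, (∀ t ≤ T, σ' t = σ t) ∧ σ' (T + 1) = z ∧
        ∀ t < T + 1, r (σ' t) (σ' (t + 1)) := by
    intro T σ z hσ hz
    refine ⟨fun t => if t ≤ T then σ t else z, fun t ht => by simp [ht], by simp, fun t ht => ?_⟩
    rcases Nat.lt_succ_iff_lt_or_eq.1 ht with h | rfl
    · simpa [h.le, Nat.succ_le_of_lt h] using hσ t h
    · simpa using hz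
  induction h with
  | single h =>
    obtain ⟨σ', h1, h2, h3⟩ := aux T σ _ hσ (hT ▸ h)
    exact ⟨T + 1, σ', by omega, h1, h2, h3⟩
  | tail _ h ih =>
    obtain ⟨T₁, σ₁, hT₁, e₁, f₁, g₁⟩ := ih
    obtain ⟨σ', h1, h2, h3⟩ := aux T₁ σ₁ _ g₁ (f₁ ▸ h)
    exact ⟨T₁ + 1, σ', by omega, fun t ht => (h1 t (by omega)).trans (e₁ t ht), h2, h3⟩

/-- A sequence of points each reachable from the previous one lies on an infinite path. -/
lemma exists_path_through {β : Type*} {r : β → β → Prop} (f : ℕ → β)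
    (hf : ∀ m, Relation.TransGen r (f m) (f (m + 1))) :
    ∃ σ : ℕ → β, σ 0 = f 0 ∧ (∀ t, r (σ t) (σ (t + 1))) ∧ ∀ m, ∃ t, σ t = f m := by
  obtain ⟨p, hp0, hp, hR⟩ := exists_seq_of_step (β := ℕ × (ℕ → β))
    (fun m q => q.2 q.1 = f m ∧ ∀ t < q.1, r (q.2 t) (q.2 (t + 1)))
    (fun q q' => q.1 < q'.1 ∧ ∀ t ≤ q.1, q'.2 t = q.2 t) (0, fun _ => f 0)
    ⟨rfl, fun t ht => absurd ht (Nat.not_lt_zero t)⟩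
    (fun m q hq => by
      obtain ⟨T', σ', h1, h2, h3, h4⟩ := exists_path_extension (hf m) q.1 q.2 hq.1 hq.2
      exact ⟨(T', σ'), ⟨h3, h4⟩, h1, h2⟩)
  have hmono : StrictMono fun m => (p m).1 := strictMono_nat_of_lt_succ fun m => (hR m).1
  have hle : ∀ m, m ≤ (p m).1 := fun m => hmono.le_apply
  have agree : ∀ m d, ∀ t ≤ (p m).1, (p (m + d)).2 t = (p m).2 t := by
    intro m d t ht
    induction d with
    | zero => rfl
    | succ d ih =>
      rw [← ih]
      exact (hR (m + d)).2 t (ht.trans (hmono.monotone (Nat.le_add_right m d)))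
  have agree' : ∀ m t, m ≤ t → t ≤ (p m).1 → (p t).2 t = (p m).2 t := by
    intro m t hmt ht
    obtain ⟨d, rfl⟩ := Nat.exists_eq_add_of_le hmt
    exact agree m d _ ht
  refine ⟨fun t => (p t).2 t, by simp [hp0], fun t => ?_, fun m => ⟨(p m).1, ?_⟩⟩
  · dsimp only
    rw [← agree t 1 t (hle t)]
    exact (hp (t + 1)).2 t (hle (t + 1))
  · dsimp only
    rw [agree' m _ (hle m) le_rfl]
    exact (hp m).1

/-- If `X` grows by about `X ^ a` and `A` grows by `X`, then `X` is of order `A ^ b⁻¹`,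
where `b = 2 - a`. -/
lemma growth_estimate {N c C a b x₀ : ℝ} (hN : 1 ≤ N) (hc : 0 < c) (hC : 0 < C) (ha : a ≤ 1)
    (hb : 1 ≤ b) (hab : a + b = 2) :
    ∃ B : ℝ, 0 < B ∧ ∀ X A h : ℕ → ℝ, X 0 = x₀ → (∀ m, 1 ≤ X m) → A 0 = 0 →
      (∀ m, A (m + 1) = A m + X m) → (∀ m, X (m + 1) = X m + N * h m) →
      (∀ m, c * X m ^ a ≤ h m) → (∀ m, h m ≤ C * X m ^ a) →
      ∀ m (y : ℝ), 1 ≤ y → (y ≤ N * A (m + 1) → y ^ b⁻¹ ≤ B * X m) ∧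
        (A m ≤ y → X (m + 1) ≤ B * y ^ b⁻¹) := by
  set K := 1 + N * C with hK
  set L := b * K ^ (b - 1) * (N * C) with hL
  have hb0 : 0 < b := by linarith
  have hN0 : 0 < N := by linarith
  have hKpos : 0 < K := by positivity
  have hLpos : 0 < L := by positivity
  set D₁ := N * (1 / (b * N * c) + 1) with hD₁
  set D₂ := K ^ b * (|x₀ ^ b| + L) with hD₂
  have hD₁pos : 0 < D₁ := by positivity
  have hD₂pos : 0 < D₂ := by positivity
  refine ⟨D₁ ^ b⁻¹ + D₂ ^ b⁻¹, by positivity, ?_⟩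
  intro X A h hX0 hX1 hA0 hA hX hlo hhi
  have hXpos : ∀ m, 0 < X m := fun m => by linarith [hX1 m]
  have hXa : ∀ m, X m ^ a ≤ X m := fun m => by
    simpa using Real.rpow_le_rpow_of_exponent_le (hX1 m) ha
  have hXmul : ∀ m, X m ^ a * X m ^ (b - 1) = X m := fun m => by
    rw [← Real.rpow_add (hXpos m), show a + (b - 1) = 1 by linarith, Real.rpow_one]
  have hXb : ∀ m, X m * X m ^ (b - 1) = X m ^ b := fun m => by
    conv_lhs => rw [← Real.rpow_one (X m), ← Real.rpow_mul (hXpos m).le, one_mul]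
    rw [← Real.rpow_add (hXpos m)]; congr 1; ring
  have hh0 : ∀ m, 0 ≤ h m := fun m =>
    le_trans (mul_nonneg hc.le (Real.rpow_nonneg (hXpos m).le _)) (hlo m)
  have hXK : ∀ m, X (m + 1) ≤ K * X m := fun m => by
    have h1 : N * h m ≤ N * (C * X m) :=
      mul_le_mul_of_nonneg_left ((hhi m).trans (mul_le_mul_of_nonneg_left (hXa m) hC.le)) hN0.le
    rw [hX, hK]; linarith
  have hAnn : ∀ m, 0 ≤ A m := fun m => by
    induction m with
    | zero => rw [hA0]
    | succ m ih => rw [hA]; linarith [hXpos m]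
  have up : ∀ m, X (m + 1) ^ b ≤ X m ^ b + L * X m := by
    intro m
    have hp := hXpos m
    have hp' := hXpos (m + 1)
    have hber := one_add_mul_self_le_rpow_one_add (s := X m / X (m + 1) - 1)
      (by have : 0 < X m / X (m + 1) := by positivity
          linarith) hb
    rw [show 1 + (X m / X (m + 1) - 1) = X m / X (m + 1) by ring,
      Real.div_rpow hp.le hp'.le, le_div_iff₀ (by positivity)] at hber
    have e : (1 + b * (X m / X (m + 1) - 1)) * X (m + 1) ^ b
        = X (m + 1) ^ b - b * (N * h m) * X (m + 1) ^ (b - 1) := by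
      rw [← hXb (m + 1)]
      have : X m = X (m + 1) - N * h m := by rw [hX]; ring
      rw [this]
      field_simp
      ring
    rw [e] at hber
    have h1 : X (m + 1) ^ (b - 1) ≤ K ^ (b - 1) * X m ^ (b - 1) := by
      rw [← Real.mul_rpow hKpos.le hp.le]
      exact Real.rpow_le_rpow hp'.le (hXK m) (by linarith)
    have h2 : b * (N * h m) * X (m + 1) ^ (b - 1)
        ≤ b * (N * (C * X m ^ a)) * (K ^ (b - 1) * X m ^ (b - 1)) := by
      have := hh0 m
      have := hhi m
      gcongr
    have h3 : b * (N * (C * X m ^ a)) * (K ^ (b - 1) * X m ^ (b - 1)) = L * X m := by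
      rw [hL]; nth_rw 3 [← hXmul m]; ring
    linarith
  have lo : ∀ m, X m ^ b + b * N * c * X m ≤ X (m + 1) ^ b := by
    intro m
    have hp := hXpos m
    have hs : 0 ≤ N * h m / X m := div_nonneg (mul_nonneg hN0.le (hh0 m)) hp.le
    have hber := one_add_mul_self_le_rpow_one_add (s := N * h m / X m) (by linarith) hb
    have e1 : X (m + 1) ^ b = X m ^ b * (1 + N * h m / X m) ^ b := by
      rw [← Real.mul_rpow hp.le (by linarith), hX]; congr 1; field_simp
    have e2 : X m ^ b * (1 + b * (N * h m / X m)) = X m ^ b + b * N * (h m * X m ^ (b - 1)) := by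
      rw [← hXb m]; field_simp
    have h1 : c * X m ≤ h m * X m ^ (b - 1) := by
      nth_rw 1 [← hXmul m]
      rw [← mul_assoc]
      exact mul_le_mul_of_nonneg_right (hlo m) (Real.rpow_nonneg hp.le _)
    have h2 := mul_le_mul_of_nonneg_left hber (Real.rpow_nonneg hp.le b)
    have h3 : b * N * (c * X m) ≤ b * N * (h m * X m ^ (b - 1)) :=
      mul_le_mul_of_nonneg_left h1 (by positivity)
    rw [e1]; linarith
  have up' : ∀ m, X m ^ b ≤ x₀ ^ b + L * A m := fun m => by
    induction m with
    | zero => rw [hX0, hA0]; linarith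
    | succ m ih => rw [hA]; linarith [up m]
  have lo' : ∀ m, b * N * c * A m ≤ X m ^ b := fun m => by
    induction m with
    | zero => rw [hA0, mul_zero]; exact Real.rpow_nonneg (hXpos 0).le _
    | succ m ih => rw [hA]; linarith [lo m]
  have inv : ∀ x : ℝ, 0 ≤ x → (x ^ b) ^ b⁻¹ = x := fun x hx =>
    Real.rpow_rpow_inv hx hb0.ne'
  intro m y hy
  have hy0 : 0 ≤ y := by linarith
  have hp := hXpos m
  constructor
  · intro hyA
    have h1 : A m ≤ 1 / (b * N * c) * X m ^ b := by
      rw [one_div, inv_mul_eq_div, le_div_iff₀ (by positivity)]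
      linarith [lo' m]
    have h2 : X m ≤ X m ^ b := by
      simpa using Real.rpow_le_rpow_of_exponent_le (hX1 m) hb
    have h3 : y ≤ D₁ * X m ^ b := by
      refine hyA.trans ?_
      rw [hD₁, hA, mul_assoc]
      exact mul_le_mul_of_nonneg_left (by linarith) hN0.le
    have h4 := Real.rpow_le_rpow hy0 h3 (inv_nonneg.2 hb0.le)
    rw [Real.mul_rpow hD₁pos.le (by positivity), inv _ hp.le] at h4
    have : 0 ≤ D₂ ^ b⁻¹ * X m := by positivity
    linarith
  · intro hyA
    have h1 : X (m + 1) ^ b ≤ K ^ b * X m ^ b := by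
      rw [← Real.mul_rpow hKpos.le hp.le]
      exact Real.rpow_le_rpow (hXpos _).le (hXK m) hb0.le
    have h2 : X m ^ b ≤ (|x₀ ^ b| + L) * y := by
      have h5 := up' m
      have h6 := le_abs_self (x₀ ^ b)
      have h7 : |x₀ ^ b| ≤ |x₀ ^ b| * y := le_mul_of_one_le_right (abs_nonneg _) hy
      have h8 : L * A m ≤ L * y := mul_le_mul_of_nonneg_left hyA hLpos.le
      linarith
    have h3 : X (m + 1) ^ b ≤ D₂ * y := by
      refine h1.trans ?_
      rw [hD₂, mul_assoc]
      exact mul_le_mul_of_nonneg_left h2 (by positivity)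
    have h4 := Real.rpow_le_rpow (Real.rpow_nonneg (hXpos _).le _) h3 (inv_nonneg.2 hb0.le)
    rw [Real.mul_rpow hD₂pos.le hy0, inv _ (hXpos _).le] at h4
    have : 0 ≤ D₁ ^ b⁻¹ * y ^ b⁻¹ := by positivity
    linarith

/-- From a state with constant `U`, one can reach another such state: level `V` at its maximum
(up to one extra unit), then let the other coordinates play the smaller game until they catch up
in `U`. Here `E` is the total deficiency of `V` with respect to its maximum `M`. -/
lemma FPReach.phase {k : ℕ} (Q : ℕ → ℕ → Prop)
    (hQ : ∀ P : ℕ, 1 ≤ P → ∃ (V : Fin (k + 1) → ℕ) (h : ℕ),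
      FPReach (fun _ => 0, fun l => if l = 0 then 1 else 0) (fun _ => P, V) ∧
        (∀ l, V l ≤ P + h) ∧ (∃ l, V l = P + h) ∧ Q P h)
    (A M E : ℕ) (V : Fin (k + 2) → ℕ) (hV : ∀ l, V l ≤ M) (hM : ∃ l, V l = M)
    (hE : ∑ l, V l + E = (k + 2) * M) :
    ∃ (h : ℕ) (V' : Fin (k + 2) → ℕ),
      Relation.TransGen FPStep (fun _ => A, V) (fun _ => A + (E + 2), V') ∧
        (∀ l, V' l ≤ M + (E + 2) + h) ∧ (∃ l, V' l = M + (E + 2) + h) ∧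
        ∑ l, V' l + (E + (k + 2) * h) = (k + 2) * (M + (E + 2) + h) ∧ Q (E + 2) h := by
  obtain ⟨p, hp⟩ := hM
  obtain ⟨V₁, h, hreach, hle, ⟨q, hq⟩, hQh⟩ := hQ (E + 2) (by omega)
  have hstep : FPStep ((fun _ => A, V) : (Fin (k + 2) → ℕ) × (Fin (k + 2) → ℕ))
      (fun l => A + if l = p then 1 else 0, fun l => V l + if l = p then 1 else 0) :=
    ⟨p, p, fun l => (hV l).trans hp.ge, fun l => le_rfl, fun l => rfl, fun l => rfl⟩
  set W : Fin (k + 2) → ℕ := p.insertNth (M + 1) fun l => M + if l = 0 then 1 else 0 with hW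
  have hfill := FPReach.fill p A (fun l => V l + if l = p then 1 else 0) W
    ((Fin.forall_iff_succAbove p).2
      ⟨by simp [hW, hp], fun l => by simpa [hW] using le_add_right (hV _)⟩)
    ((Fin.forall_iff_succAbove p).2
      ⟨by simp [hW, hp], fun l => by
        simp only [hW, Fin.insertNth_apply_succAbove, hp]; split_ifs <;> simp⟩) 1
  have hsum : ∑ l, W l - ∑ l, (V l + if l = p then 1 else 0) = E + 1 := by
    have h1 : ∑ l, W l = (k + 2) * M + 2 := by
      simp [hW, Fin.sum_univ_succAbove _ p, Finset.sum_add_distrib]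
      ring
    have h2 : ∑ l, (V l + if l = p then 1 else 0) = ∑ l, V l + 1 := by
      simp [Finset.sum_add_distrib]
    omega
  rw [hsum] at hfill
  have hlift := (hreach.translate A M).insertNth p (a := A + (E + 2)) (b := M + 1)
    ⟨0, le_rfl⟩ ⟨0, by simp⟩
  have e₁ : (p.insertNth (A + (E + 2)) fun _ => A + 0 : Fin (k + 2) → ℕ) =
      fun l => A + if l = p then 1 + (E + 1) else 0 := by
    ext l; cases l using p.succAboveCases <;> simp
    omega
  have e₂ : (p.insertNth (A + (E + 2)) fun _ => A + (E + 2) : Fin (k + 2) → ℕ) =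
      fun _ => A + (E + 2) := by
    ext l; cases l using p.succAboveCases <;> simp
  dsimp only at hlift
  rw [e₁, e₂] at hlift
  have htail := hfill.trans hlift
  have htot := FPReach.sum_add_sum (.head hstep htail)
  refine ⟨h, _, Relation.TransGen.head' hstep htail, ?_, ⟨p.succAbove q, ?_⟩, ?_, hQh⟩
  · refine (Fin.forall_iff_succAbove p).2 ⟨by simp; omega, fun l => ?_⟩
    have := hle l
    simp; omega
  · simp [hq]; omega
  · simp only [Finset.sum_const, Finset.card_univ, Fintype.card_fin, smul_eq_mul] at htot
    linarith

lemma FPReach.exists_phases {k : ℕ} (Q : ℕ → ℕ → Prop)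
    (hQ : ∀ P : ℕ, 1 ≤ P → ∃ (V : Fin (k + 1) → ℕ) (h : ℕ),
      FPReach (fun _ => 0, fun l => if l = 0 then 1 else 0) (fun _ => P, V) ∧
        (∀ l, V l ≤ P + h) ∧ (∃ l, V l = P + h) ∧ Q P h)
    (M₀ E₀ : ℕ) (V₀ : Fin (k + 2) → ℕ) (hV : ∀ l, V₀ l ≤ M₀) (hM : ∃ l, V₀ l = M₀)
    (hE : ∑ l, V₀ l + E₀ = (k + 2) * M₀) :
    ∃ (V : ℕ → Fin (k + 2) → ℕ) (A M E h : ℕ → ℕ), V 0 = V₀ ∧ A 0 = 0 ∧ E 0 = E₀ ∧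
      (∀ m, Relation.TransGen FPStep (fun _ => A m, V m) (fun _ => A (m + 1), V (m + 1))) ∧
      (∀ m l, V m l ≤ M m) ∧ (∀ m, ∃ l, V m l = M m) ∧
      (∀ m, A (m + 1) = A m + (E m + 2)) ∧ (∀ m, E (m + 1) = E m + (k + 2) * h m) ∧
      (∀ m, (k + 2) * M m + E₀ = (k + 2) * (A m + M₀) + E m) ∧
      (∀ m, Q (E m + 2) (h m)) := by
  obtain ⟨f, hf0, hf, hR⟩ := exists_seq_of_step (β := (Fin (k + 2) → ℕ) × ℕ × ℕ × ℕ)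
    (fun _ q => (∀ l, q.1 l ≤ q.2.2.1) ∧ (∃ l, q.1 l = q.2.2.1) ∧
      ∑ l, q.1 l + q.2.2.2 = (k + 2) * q.2.2.1)
    (fun q q' => ∃ h, Relation.TransGen FPStep (fun _ => q.2.1, q.1) (fun _ => q'.2.1, q'.1) ∧
      q'.2.1 = q.2.1 + (q.2.2.2 + 2) ∧ q'.2.2.1 = q.2.2.1 + (q.2.2.2 + 2) + h ∧
      q'.2.2.2 = q.2.2.2 + (k + 2) * h ∧ Q (q.2.2.2 + 2) h)
    (V₀, 0, M₀, E₀) ⟨hV, hM, hE⟩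
    (fun m q ⟨h1, h2, h3⟩ => by
      obtain ⟨h, V', h4, h5, h6, h7, h8⟩ := FPReach.phase Q hQ q.2.1 q.2.2.1 q.2.2.2 q.1 h1 h2 h3
      exact ⟨(V', q.2.1 + (q.2.2.2 + 2), q.2.2.1 + (q.2.2.2 + 2) + h, q.2.2.2 + (k + 2) * h),
        ⟨h5, h6, h7⟩, h, h4, rfl, rfl, rfl, h8⟩)
  choose h h1 h2 h3 h4 h5 using hR
  refine ⟨fun m => (f m).1, fun m => (f m).2.1, fun m => (f m).2.2.1, fun m => (f m).2.2.2, h,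
    by simp [hf0], by simp [hf0], by simp [hf0], h1, fun m => (hf m).1, fun m => (hf m).2.1,
    h2, h4, fun m => ?_, h5⟩
  induction m with
  | zero => simp [hf0]
  | succ m ih =>
    simp only [h2, h3, h4] at ih ⊢
    linarith

lemma exists_between_succ {A : ℕ → ℕ} (h0 : A 0 = 0) (hA : StrictMono A) (P : ℕ) :
    ∃ m, A m ≤ P ∧ P < A (m + 1) := by
  have hex : ∃ m, P < A (m + 1) := ⟨P, hA.le_apply (x := P + 1)⟩
  refine ⟨Nat.find hex, ?_, Nat.find_spec hex⟩
  rcases Nat.eq_zero_or_pos (Nat.find hex) with h | h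
  · rw [h, h0]; exact Nat.zero_le _
  · have := Nat.find_min hex (Nat.sub_lt h Nat.one_pos)
    rwa [Nat.sub_add_cancel h, not_lt] at this

lemma phase_growth_estimate (k : ℕ) {c C : ℝ} (hc : 0 < c) (hC : 0 < C) (E₀ : ℕ) :
    ∃ B : ℝ, 0 < B ∧ ∀ A E h : ℕ → ℕ, A 0 = 0 → E 0 = E₀ →
      (∀ m, A (m + 1) = A m + (E m + 2)) → (∀ m, E (m + 1) = E m + (k + 2) * h m) →
      (∀ m, c * ((E m + 2 : ℕ) : ℝ) ^ ((k : ℝ) / (k + 1)) ≤ h m ∧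
        (h m : ℝ) ≤ C * ((E m + 2 : ℕ) : ℝ) ^ ((k : ℝ) / (k + 1))) →
      ∀ m P : ℕ, 1 ≤ P →
        (P ≤ (k + 2) * A (m + 1) → (P : ℝ) ^ (((k : ℝ) + 1) / (k + 2)) ≤ B * (E m + 2)) ∧
        (A m ≤ P → (E (m + 1) : ℝ) + 2 ≤ B * (P : ℝ) ^ (((k : ℝ) + 1) / (k + 2))) := by
  have hk : (0 : ℝ) < k + 1 := by positivity
  obtain ⟨B, hB, H⟩ := growth_estimate (N := k + 2) (c := c) (C := C) (a := (k : ℝ) / (k + 1))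
    (b := ((k : ℝ) + 2) / (k + 1)) (x₀ := E₀ + 2) (by linarith) hc hC
    (by rw [div_le_one hk]; linarith) (by rw [le_div_iff₀ hk]; linarith) (by field_simp; ring)
  refine ⟨B, hB, fun A E h hA0 hE0 hA hE hh m P hP => ?_⟩
  have key := H (fun m => E m + 2) (fun m => A m) (fun m => h m) (by simp [hE0])
    (fun m => by have : (0 : ℝ) ≤ E m := by positivity
                 linarith)
    (by simp [hA0]) (fun m => by simp [hA]) (fun m => by simp [hE]; ring)
    (fun m => by simpa using (hh m).1) (fun m => by simpa using (hh m).2) m P (by exact_mod_cast hP)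
  rw [inv_div] at key
  exact ⟨fun h => key.1 (by exact_mod_cast h), fun h => key.2 (by exact_mod_cast h)⟩

/-- Starting from `U = 0`, `V = e₀`, any state with constant `U = P` can be reached with a gap of
order `P ^ (k / (k + 1))`, where `k + 1` is the number of coordinates. -/
lemma FPReach.exists_constant (k : ℕ) :
    ∃ c C : ℝ, 0 < c ∧ 0 < C ∧ ∀ P : ℕ, 1 ≤ P → ∃ (V : Fin (k + 1) → ℕ) (h : ℕ),
      FPReach (fun _ => 0, fun l => if l = 0 then 1 else 0) (fun _ => P, V) ∧
        (∀ l, V l ≤ P + h) ∧ (∃ l, V l = P + h) ∧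
        (c * (P : ℝ) ^ ((k : ℝ) / (k + 1)) ≤ h ∧ (h : ℝ) ≤ C * (P : ℝ) ^ ((k : ℝ) / (k + 1))) := by
  induction k with
  | zero =>
    refine ⟨1, 1, one_pos, one_pos, fun P _ => ?_⟩
    obtain ⟨k', hk'⟩ := FPReach.balanced 0 0 P
    exact ⟨_, 1, hk', fun l => by split_ifs <;> simp, ⟨k', by simp⟩, by simp⟩
  | succ k ih =>
    obtain ⟨c, C, hc, hC, H⟩ := ih
    obtain ⟨B, hB, hgrowth⟩ := phase_growth_estimate k hc hC (k + 1)
    obtain ⟨V, A, M, E, h, hV0, hA0, hE0, hreach, hle, hmax, hA, hE, hME, hh⟩ :=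
      FPReach.exists_phases _ H 1 (k + 1) (fun l => if l = 0 then 1 else 0)
        (fun l => by split_ifs <;> simp) ⟨0, by simp⟩ (by simp; ring)
    refine ⟨(B * (2 * (k + 2)))⁻¹, B, by positivity, hB, fun P hP => ?_⟩
    obtain ⟨m, hm, hm'⟩ := exists_between_succ hA0
      (strictMono_nat_of_lt_succ fun m => by rw [hA]; omega) P
    obtain ⟨x, rfl⟩ := Nat.exists_eq_add_of_le' hm
    obtain ⟨k', hk'⟩ := FPReach.balanced (k + 1) 0 x
    have hr : ∀ m, FPReach (fun _ => 0, V 0) (fun _ => A m, V m) := fun m => by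
      induction m with
      | zero => rw [hA0]
      | succ m ih => exact ih.trans (hreach m).to_reflTransGen
    have hpath := ((hr m).perm (Equiv.swap 0 k')).translate x x
    have e : (fun l => x + V 0 (Equiv.swap 0 k' l)) = fun l => x + if l = k' then 1 else 0 := by
      funext l
      simp [hV0, ← Equiv.eq_symm_apply]
    dsimp only at hpath
    rw [e] at hpath
    obtain ⟨d, hd⟩ : ∃ d, M m = A m + d := by
      refine Nat.exists_eq_add_of_le (Nat.le_of_mul_le_mul_left (c := k + 2) ?_ (Nat.succ_pos _))
      have := hME m
      linarith
    have hdE : (k + 2) * d = E m + 1 := by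
      have := hME m
      rw [hd] at this
      linarith
    have hdE' : ((k : ℝ) + 2) * d = E m + 1 := by exact_mod_cast hdE
    have hk0 : (0 : ℝ) ≤ k := by positivity
    have hE0' : (0 : ℝ) ≤ E m := by positivity
    obtain ⟨l₀, hl₀⟩ := hmax m
    refine ⟨_, d, hk'.trans hpath, fun l => ?_, ⟨(Equiv.swap 0 k').symm l₀, ?_⟩, ?_, ?_⟩
    · have := hle m (Equiv.swap 0 k' l)
      omega
    · simp only [Equiv.apply_symm_apply]; omega
    · have h1 := (hgrowth A E h hA0 hE0 hA hE hh m (x + A m) hP).1 (by nlinarith)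
      rw [inv_mul_le_iff₀ (by positivity)]
      push_cast at h1 ⊢
      rw [show (k : ℝ) + 1 + 1 = k + 2 by ring]
      refine h1.trans ?_
      rw [mul_assoc]
      refine mul_le_mul_of_nonneg_left ?_ hB.le
      linarith
    · have h1 := (hgrowth A E h hA0 hE0 hA hE hh m (x + A m) hP).2 hm
      have h2 : E m ≤ E (m + 1) := by rw [hE]; omega
      have h3 : (E m : ℝ) ≤ E (m + 1) := by exact_mod_cast h2
      push_cast at h1 ⊢
      rw [show (k : ℝ) + 1 + 1 = k + 2 by ring]
      refine le_trans ?_ h1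
      have h4 : (0 : ℝ) ≤ d := by positivity
      nlinarith

lemma gap_eq {n : ℕ} {U V : ℕ → Fin n → ℕ} {t : ℕ} {i j : Fin n} (hi : ∀ l, V t l ≤ V t i)
    (hj : ∀ l, U t j ≤ U t l) : gap n U V t = (V t i : ℤ) - U t j := by
  have : Nonempty (Fin n) := ⟨i⟩
  have h1 : (⨆ l, V t l) = V t i :=
    le_antisymm (ciSup_le hi) (le_ciSup (Set.finite_range (V t)).bddAbove i)
  have h2 : (⨅ l, U t l) = U t j :=
    le_antisymm (ciInf_le (Set.finite_range (U t)).bddBelow j) (le_ciInf hj)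
  rw [gap, h1, h2]

lemma IsDynamic.gap_monotone {n : ℕ} {U V : ℕ → Fin n → ℕ} (h : IsDynamic n U V) :
    Monotone (gap n U V) := by
  refine monotone_nat_of_le_succ fun t => ?_
  obtain ⟨i, j, hi, hj, hU, hV⟩ := h.2.2 t
  obtain ⟨i', j', hi', hj', -, -⟩ := h.2.2 (t + 1)
  rw [gap_eq hi hj, gap_eq hi' hj']
  have h1 := hi' i
  have h2 := hj' j
  rw [hV i] at h1
  rw [hU j] at h2
  by_cases hij : i = j
  · subst hij; simp at h1 h2; omega
  · simp [hij, Ne.symm hij] at h1 h2; omega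

lemma IsDynamic.one_le_gap {n : ℕ} (hn : 2 ≤ n) {U V : ℕ → Fin n → ℕ} (h : IsDynamic n U V)
    {t : ℕ} (ht : 1 ≤ t) : 1 ≤ gap n U V t := by
  refine le_trans ?_ (h.gap_monotone ht)
  obtain ⟨i, j, -, -, hU, hV⟩ := h.2.2 0
  obtain ⟨i', j', hi', hj', -, -⟩ := h.2.2 1
  rw [gap_eq hi' hj']
  have : Nontrivial (Fin n) := Fin.nontrivial_iff_two_le.2 hn
  obtain ⟨l, hl⟩ := exists_ne i
  have h1 := hi' j
  have h2 := hj' l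
  have hUl := hU l
  have hVj := hV j
  simp [hl, h.1] at hUl
  simp [h.2.1] at hVj
  omega

lemma FPStep.sum_fst_path {n : ℕ} {σ : ℕ → (Fin n → ℕ) × (Fin n → ℕ)}
    (h0 : ∀ l, (σ 0).1 l = 0) (h : ∀ t, FPStep (σ t) (σ (t + 1))) (t : ℕ) :
    ∑ l, (σ t).1 l = t := by
  induction t with
  | zero => simp [h0]
  | succ t ih => rw [(h t).sum_fst, ih]

/-- For every number `k + 2` of coordinates there is a dynamic whose gap has order
`t ^ ((k + 1) / (k + 2))`. -/
lemma exists_isDynamic_gap_bounds (k : ℕ) :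
    ∃ U V : ℕ → Fin (k + 2) → ℕ, IsDynamic (k + 2) U V ∧ ∃ c C : ℝ, 0 < c ∧ ∀ t : ℕ, 1 ≤ t →
      c * (t : ℝ) ^ (((k : ℝ) + 1) / (k + 2)) ≤ (gap (k + 2) U V t : ℝ) ∧
      (gap (k + 2) U V t : ℝ) ≤ C * (t : ℝ) ^ (((k : ℝ) + 1) / (k + 2)) := by
  obtain ⟨c, C, hc, hC, H⟩ := FPReach.exists_constant k
  obtain ⟨B, hB, hgrowth⟩ := phase_growth_estimate k hc hC 0
  obtain ⟨V, A, M, E, h, hV0, hA0, hE0, hreach, hle, hmax, hA, hE, hME, hh⟩ :=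
    FPReach.exists_phases _ H 0 0 (fun _ => 0) (fun l => le_rfl) ⟨0, rfl⟩ (by simp)
  obtain ⟨σ, hσ0, hσ, hσm⟩ :=
    exists_path_through (r := FPStep) (fun m => (fun _ => A m, V m)) hreach
  have hdyn : IsDynamic (k + 2) (fun t => (σ t).1) (fun t => (σ t).2) :=
    ⟨by simp [hσ0, hA0], by simp [hσ0, hV0], hσ⟩
  have hvisit : ∀ m, σ ((k + 2) * A m) = (fun _ => A m, V m) := fun m => by
    obtain ⟨t, ht⟩ := hσm m
    have hs := FPStep.sum_fst_path (by simp [hσ0, hA0]) hσ t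
    rw [ht] at hs
    simp at hs
    rw [hs, ht]
  have hgap : ∀ m, ((k : ℝ) + 2) *
      (gap (k + 2) (fun t => (σ t).1) (fun t => (σ t).2) ((k + 2) * A m) : ℝ) = E m := fun m => by
    obtain ⟨l, hl⟩ := hmax m
    rw [gap_eq (i := l) (j := 0) (by simpa [hvisit, hl] using hle m) (by simp [hvisit])]
    have h1 : ((k : ℝ) + 2) * M m + 0 = (k + 2) * (A m + 0) + E m := by exact_mod_cast hME m
    simp [hvisit, hl]
    linarith
  refine ⟨_, _, hdyn, (B * (k + 4))⁻¹, B, by positivity, fun t ht => ?_⟩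
  obtain ⟨m, hm, hm'⟩ := exists_between_succ (A := fun m => (k + 2) * A m) (by simp [hA0])
    (strictMono_nat_of_lt_succ fun m => by simp [hA]) t
  have g1 : (1 : ℝ) ≤ gap (k + 2) (fun t => (σ t).1) (fun t => (σ t).2) t := by
    exact_mod_cast hdyn.one_le_gap (by omega) ht
  have g2 : (gap (k + 2) (fun t => (σ t).1) (fun t => (σ t).2) ((k + 2) * A m) : ℝ) ≤
      gap (k + 2) (fun t => (σ t).1) (fun t => (σ t).2) t := by
    exact_mod_cast hdyn.gap_monotone hm
  have g3 : (gap (k + 2) (fun t => (σ t).1) (fun t => (σ t).2) t : ℝ) ≤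
      gap (k + 2) (fun t => (σ t).1) (fun t => (σ t).2) ((k + 2) * A (m + 1)) := by
    exact_mod_cast hdyn.gap_monotone hm'.le
  have e1 := hgap m
  have e2 := hgap (m + 1)
  have hest := hgrowth A E h hA0 hE0 hA hE hh m t ht
  have hk0 : (0 : ℝ) ≤ k := by positivity
  constructor
  · rw [inv_mul_le_iff₀ (by positivity), mul_assoc]
    refine (hest.1 hm'.le).trans (mul_le_mul_of_nonneg_left ?_ hB.le)
    nlinarith
  · refine le_trans ?_ (hest.2 (by nlinarith))
    nlinarith

/-- For every `n ≥ 2` there exist a dynamic `(U, V)` for `Iₙ` and constants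
`C ≥ c > 0` such that for every `t ≥ 1`, `c·t^((n−1)/n) ≤ gap(t) ≤ C·t^((n−1)/n)`;
consequently the normalized duality gap `gap(t)/t` is bounded above and below by
constant multiples of `t^(−1/n)`. -/
theorem stmt_1 :
    ∀ n : ℕ, 2 ≤ n →
      ∃ U V : ℕ → Fin n → ℕ, IsDynamic n U V ∧
        ∃ c C : ℝ, 0 < c ∧ c ≤ C ∧
          (∀ t : ℕ, 1 ≤ t →
            c * (t : ℝ) ^ (((n : ℝ) - 1) / n) ≤ (gap n U V t : ℝ) ∧
            (gap n U V t : ℝ) ≤ C * (t : ℝ) ^ (((n : ℝ) - 1) / n)) ∧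
          (∀ t : ℕ, 1 ≤ t →
            c * (t : ℝ) ^ (-(1 : ℝ) / n) ≤ (gap n U V t : ℝ) / t ∧
            (gap n U V t : ℝ) / t ≤ C * (t : ℝ) ^ (-(1 : ℝ) / n)) := by
  intro n hn
  obtain ⟨k, rfl⟩ := Nat.exists_eq_add_of_le' hn
  obtain ⟨U, V, hdyn, c, C, hc, H⟩ := exists_isDynamic_gap_bounds k
  have e₁ : (((k + 2 : ℕ) : ℝ) - 1) / (k + 2 : ℕ) = ((k : ℝ) + 1) / (k + 2) := by
    push_cast; congr 1; ring
  have hcC : c ≤ C := by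
    have := H 1 le_rfl
    simp only [Nat.cast_one, Real.one_rpow, mul_one] at this
    exact this.1.trans this.2
  refine ⟨U, V, hdyn, c, C, hc, hcC, fun t ht => e₁ ▸ H t ht, fun t ht => ?_⟩
  have ht0 : (0 : ℝ) < t := by exact_mod_cast ht
  have e₂ : (t : ℝ) ^ (-(1 : ℝ) / (k + 2 : ℕ)) = (t : ℝ) ^ (((k : ℝ) + 1) / (k + 2)) / t := by
    rw [← Real.rpow_sub_one ht0.ne']
    congr 1
    push_cast
    field_simp
    ring
  rw [e₂, ← mul_div_assoc, ← mul_div_assoc]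
  exact ⟨div_le_div_of_nonneg_right (H t ht).1 ht0.le, div_le_div_of_nonneg_right (H t ht).2 ht0.le⟩
end

section
/- For every n ≥ 2 there exist a dynamic (U,V) for the n×n identity matrix I_n and real constants C ≥ c > 0 such that infinitely many natural numbers T satisfy both U(nT) = (T, T, ..., T) and c·T^((n−1)/n) ≤ gap(nT) ≤ C·T^((n−1)/n). -/
/-- One step of fictitious play in which both players only use the strategies in `s`. -/
def PlayStep {ι : Type*} [DecidableEq ι] (s : Finset ι) (p q : (ι → ℕ) × (ι → ℕ)) : Prop :=
  ∃ i ∈ s, ∃ j ∈ s, (∀ l ∈ s, p.2 l ≤ p.2 i) ∧ (∀ l ∈ s, p.1 j ≤ p.1 l) ∧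
    q.1 = p.1 + Pi.single i 1 ∧ q.2 = p.2 + Pi.single j 1

/-- On `s`, the first component is constantly `t`, the maximum of the second component is `M`,
and the second component falls short of the constant function `M` by `D` in total. -/
structure BalancedState {ι : Type*} (s : Finset ι) (t M D : ℕ) (p : (ι → ℕ) × (ι → ℕ)) : Prop where
  fst_eq : ∀ i ∈ s, p.1 i = t
  snd_le : ∀ i ∈ s, p.2 i ≤ M
  exists_eq : ∃ i ∈ s, p.2 i = M
  sum_add : ∑ i ∈ s, p.2 i + D = s.card * M

/-- Every balanced state of deficit `D` on `n` strategies can be played to a balanced state in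
which every strategy has been used `k` more times by the first player, and in which the
difference between maximum and minimum has grown by `h`. -/
def Passage (n D k h : ℕ) : Prop :=
  ∀ (N : ℕ) (s : Finset (Fin N)), s.card = n → ∀ p t M, BalancedState s t M D p →
    ∃ q, Relation.ReflTransGen (PlayStep s) p q ∧ BalancedState s (t + k) (M + k + h) (D + n * h) q

open Relation

section Play

variable {ι : Type*} [DecidableEq ι] {s : Finset ι} {p q : (ι → ℕ) × (ι → ℕ)}

theorem PlayStep.le (h : PlayStep s p q) : p.1 ≤ q.1 ∧ p.2 ≤ q.2 := by
  obtain ⟨i, -, j, -, -, -, h1, h2⟩ := h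
  rw [h1, h2]
  exact ⟨le_self_add, le_self_add⟩

theorem PlayStep.eq_of_notMem (h : PlayStep s p q) {a : ι} (ha : a ∉ s) :
    q.1 a = p.1 a ∧ q.2 a = p.2 a := by
  obtain ⟨i, hi, j, hj, -, -, h1, h2⟩ := h
  rw [h1, h2]
  have h3 : a ≠ i := fun h => ha (h ▸ hi)
  have h4 : a ≠ j := fun h => ha (h ▸ hj)
  simp [h3, h4]

theorem le_of_play (h : ReflTransGen (PlayStep s) p q) : p.1 ≤ q.1 ∧ p.2 ≤ q.2 := by
  induction h with
  | refl => exact ⟨le_rfl, le_rfl⟩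
  | tail _ h ih => exact ⟨ih.1.trans h.le.1, ih.2.trans h.le.2⟩

theorem play_eq_of_notMem (h : ReflTransGen (PlayStep s) p q) {a : ι} (ha : a ∉ s) :
    q.1 a = p.1 a ∧ q.2 a = p.2 a := by
  induction h with
  | refl => exact ⟨rfl, rfl⟩
  | tail _ h ih =>
    exact ⟨(h.eq_of_notMem ha).1.trans ih.1, (h.eq_of_notMem ha).2.trans ih.2⟩

theorem play_insert (h : ReflTransGen (PlayStep s) p q) {a : ι} (ha : a ∉ s)
    (hV : ∃ i ∈ s, p.2 a ≤ p.2 i) (hU : ∀ i ∈ s, q.1 i ≤ p.1 a) :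
    ReflTransGen (PlayStep (insert a s)) p q := by
  induction h using ReflTransGen.head_induction_on with
  | refl => exact .refl
  | @head p p' h h' ih =>
    have hm := h.le
    have hm' := le_of_play h'
    have hne := h.eq_of_notMem ha
    refine .head ?_ (ih ?_ ?_)
    · obtain ⟨i, hi, j, hj, hmax, hmin, h1, h2⟩ := h
      refine ⟨i, by simp [hi], j, by simp [hj], ?_, ?_, h1, h2⟩
      · obtain ⟨l, hl, hal⟩ := hV
        simpa using ⟨hal.trans (hmax l hl), hmax⟩
      · simpa using ⟨(hm.1 j).trans ((hm'.1 j).trans (hU j hj)), hmin⟩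
    · obtain ⟨l, hl, hal⟩ := hV
      exact ⟨l, hl, by rw [hne.2]; exact hal.trans (hm.2 l)⟩
    · rw [hne.1]; exact hU

theorem sum_fst_of_playStep [Fintype ι] (h : PlayStep s p q) :
    ∑ i, q.1 i = ∑ i, p.1 i + 1 := by
  obtain ⟨i, hi, j, hj, -, -, h1, h2⟩ := h
  simp [h1, Finset.sum_add_distrib]

/-- While `a` is a best reply of the first player, the second player can raise the strategies
in `r` up to the level of `a`. -/
theorem exists_play_fill {a : ι} {r : Finset ι} {U V : ι → ℕ} {t d : ℕ} (has : a ∈ s)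
    (hrs : r ⊆ s) (har : a ∉ r) (hVa : ∀ l ∈ s, V l ≤ V a) (hr : ∀ l ∈ r, U l = t)
    (hs : ∀ l ∈ s, t ≤ U l) (hd : ∑ l ∈ r, V l + d = r.card * V a) (K : ℕ) (hK : K ≤ d) :
    ∃ V' : ι → ℕ, ReflTransGen (PlayStep s) (U, V) (U + Pi.single a K, V') ∧
      (∀ l ∉ r, V' l = V l) ∧ (∀ l ∈ s, V' l ≤ V a) ∧
      ∑ l ∈ r, V' l = ∑ l ∈ r, V l + K := by
  induction K with
  | zero => exact ⟨V, by simpa using ReflTransGen.refl, fun _ _ => rfl, hVa, by simp⟩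
  | succ K ih =>
    obtain ⟨V', hplay, heq, hle, hsum⟩ := ih (by omega)
    obtain ⟨j, hj, hjlt⟩ : ∃ j ∈ r, V' j < V a := by
      by_contra! hcon
      have := Finset.card_nsmul_le_sum r V' (V a) hcon
      rw [smul_eq_mul] at this
      have := hsum ▸ this
      omega
    have hja : j ≠ a := fun h => har (h ▸ hj)
    refine ⟨V' + Pi.single j 1, hplay.tail ⟨a, has, j, hrs hj, ?_, ?_, ?_, rfl⟩, ?_, ?_, ?_⟩
    · simpa [heq a har] using hle
    · intro l hl
      simpa [hja, hr j hj] using le_add_right (hs l hl)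
    · simp [add_assoc, ← Pi.single_add]
    · intro l hl
      have : l ≠ j := fun h => hl (h ▸ hj)
      simp [this, heq l hl]
    · intro l hl
      by_cases h : l = j
      · subst h; simpa using hjlt
      · simpa [h] using hle l hl
    · simp [Finset.sum_add_distrib, hsum, Finset.sum_pi_single', hj, add_assoc]

end Play

theorem Passage.exists_play_insert {n x k h N : ℕ} (hP : Passage n x k h) {s : Finset (Fin N)}
    {a : Fin N} (ha : a ∉ s) (hs : s.card = n) {p : (Fin N → ℕ) × (Fin N → ℕ)} {t M D : ℕ}
    (hb : BalancedState s t M x p) (hVa : p.2 a ≤ M) (hUa : p.1 a = t + k)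
    (hD : D + p.2 a = x + n * h + (M + k + h)) :
    ∃ q, ReflTransGen (PlayStep (insert a s)) p q ∧
      BalancedState (insert a s) (t + k) (M + k + h) D q := by
  obtain ⟨q, hq, hbq⟩ := hP N s hs p t M hb
  have hne := play_eq_of_notMem hq ha
  refine ⟨q, play_insert hq ha ?_ ?_, ?_, ?_, ?_, ?_⟩
  · obtain ⟨i, hi, hiM⟩ := hb.exists_eq
    exact ⟨i, hi, hiM ▸ hVa⟩
  · intro i hi
    rw [hbq.fst_eq i hi, hUa]
  · simpa [hne.1, hUa] using hbq.fst_eq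
  · simpa [hne.2, show p.2 a ≤ M + k + h by omega] using hbq.snd_le
  · obtain ⟨i, hi, hiM⟩ := hbq.exists_eq
    exact ⟨i, by simp [hi], hiM⟩
  · have := hbq.sum_add
    rw [Finset.sum_insert ha, Finset.card_insert_of_notMem ha, hne.2, add_mul]
    rw [hs] at *
    omega

theorem Passage.zero (n D : ℕ) : Passage n D 0 0 :=
  fun _ _ _ p _ _ hb => ⟨p, .refl, by simpa using hb⟩

theorem Passage.trans {n D k h k' h' : ℕ} (h₁ : Passage n D k h)
    (h₂ : Passage n (D + n * h) k' h') : Passage n D (k + k') (h + h') := by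
  intro N s hs p t M hb
  obtain ⟨q, hq, hbq⟩ := h₁ N s hs p t M hb
  obtain ⟨q', hq', hbq'⟩ := h₂ N s hs q _ _ hbq
  refine ⟨q', hq.trans hq', ?_⟩
  convert hbq' using 1 <;> ring

theorem Passage.one (k : ℕ) : Passage 1 0 k 0 := by
  induction k with
  | zero => exact .zero 1 0
  | succ k ih =>
    refine Passage.trans (h := 0) (h' := 0) ih ?_
    intro N s hs p t M hb
    obtain ⟨a, rfl⟩ := Finset.card_eq_one.1 hs
    have h1 := hb.fst_eq
    have h2 := hb.exists_eq
    simp only [Finset.mem_singleton, forall_eq, exists_eq_left] at h1 h2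
    refine ⟨(p.1 + Pi.single a 1, p.2 + Pi.single a 1), .single ?_, ?_, ?_, ?_, ?_⟩
    · exact ⟨a, by simp, a, by simp, by simp, by simp, rfl, rfl⟩
    all_goals simp [h1, h2]

/-- The first player uses a best reply `a` until the total deficit has dropped to `x`; then `a`
is left out until the other strategies have caught up with it. -/
theorem Passage.succ {n D k h x ε : ℕ} (hn : 0 < n) (hε : ε ≤ 1) (hP : Passage n x k h)
    (hD : D + (n + 1) * ε = k + x) (hk : D + (n + 1) * ε ≤ n * k) :
    Passage (n + 1) D k (ε + h) := by
  intro N s hs p t M hb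
  obtain ⟨a, has, haM⟩ := hb.exists_eq
  obtain ⟨U, V⟩ := p
  obtain ⟨r, har, rfl⟩ : ∃ r, a ∉ r ∧ s = insert a r :=
    ⟨s.erase a, by simp, (Finset.insert_erase has).symm⟩
  have hr : r.card = n := by
    rw [Finset.card_insert_of_notMem har] at hs; omega
  have hU := hb.fst_eq
  have hV := hb.snd_le
  have hsum := hb.sum_add
  dsimp only at hU hV hsum haM
  rw [Finset.sum_insert har, hs, haM] at hsum
  have hra : ∀ l ∈ r, l ≠ a := fun l hl h => har (h ▸ hl)
  have hstep : ReflTransGen (PlayStep (insert a r)) (U, V)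
      (U + Pi.single a ε, V + Pi.single a ε) := by
    interval_cases ε
    · simpa using ReflTransGen.refl
    · exact .single ⟨a, has, a, has, by simpa [haM] using hV,
        by intro l hl; simp [hU l hl, hU a has], rfl, rfl⟩
  have hsum1 : ∑ l ∈ r, (V + Pi.single a ε : Fin N → ℕ) l = ∑ l ∈ r, V l :=
    Finset.sum_congr rfl fun l hl => by simp [hra l hl]
  obtain ⟨b, hbr, hbmax⟩ := r.exists_max_image V (Finset.card_pos.1 (hr ▸ hn))
  have hbM : V b ≤ M := hV b (by simp [hbr])
  obtain ⟨K, hK⟩ : ∃ K, V b + K = M + ε := ⟨M + ε - V b, by omega⟩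
  have hKD : n * K ≤ D + n * ε := by
    have h1 : ∑ l ∈ r, V l ≤ n * V b := by
      simpa [hr] using Finset.sum_le_card_nsmul r V (V b) hbmax
    have h2 : n * V b + n * K = n * M + n * ε := by rw [← mul_add, hK, mul_add]
    have h3 : (n + 1) * M = n * M + M := by ring
    omega
  have hKk : K + ε ≤ k := by
    have h1 : n * K + ε ≤ n * k := by linarith
    by_contra! hcon
    interval_cases ε
    · nlinarith
    · have : n * k ≤ n * K := Nat.mul_le_mul_left n (by omega)
      omega
  have hVε : ∀ l ∈ insert a r, (V + Pi.single a ε : Fin N → ℕ) l ≤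
      (V + Pi.single a ε : Fin N → ℕ) a := by
    intro l hl
    rcases eq_or_ne l a with rfl | h
    · exact le_rfl
    · have := hV l hl
      simp only [Pi.add_apply, Pi.single_eq_same, Pi.single_eq_of_ne h]
      omega
  have hUε : ∀ (c : ℕ), ∀ l ∈ insert a r, t ≤ (U + Pi.single a c : Fin N → ℕ) l := by
    intro c l hl
    simp [hU l hl]
  obtain ⟨V₁, hplay₁, heq₁, hle₁, hs₁⟩ := exists_play_fill (r := {b}) (t := t) (d := K)
    (U := U + Pi.single a ε) (V := V + Pi.single a ε) has (by simp [hbr])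
    (by simpa using (hra b hbr).symm) hVε
    (by simp [hra b hbr, hU b (by simp [hbr])]) (hUε ε)
    (by simp [hra b hbr, haM, hK]) K le_rfl
  have hV₁a : V₁ a = M + ε := by
    rw [heq₁ a (by simpa using (hra b hbr).symm)]; simp [haM]
  have hV₁b : V₁ b = M + ε := by
    simpa [hra b hbr, hK] using hs₁
  have hs₁' : ∑ l ∈ r, V₁ l = ∑ l ∈ r, V l + K := by
    rw [← Finset.add_sum_erase r V hbr, ← Finset.add_sum_erase r V₁ hbr, hV₁b, ← hK,
      Finset.sum_congr rfl (g := V) fun l hl => ?_]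
    · ring
    · rw [Finset.mem_erase] at hl
      rw [heq₁ l (by simpa using hl.1)]
      simp [hra l hl.2]
  rw [show (V + Pi.single a ε : Fin N → ℕ) a = M + ε by simp [haM]] at hle₁
  have e1 : (n + 1) * M = n * M + M := by ring
  have e2 : (n + 1) * ε = n * ε + ε := by ring
  obtain ⟨V₂, hplay₂, heq₂, hle₂, hs₂⟩ := exists_play_fill (s := insert a r) (r := r) (t := t)
    (d := D + n * ε - K) (U := U + Pi.single a ε + Pi.single a K) (V := V₁) has
    (by simp) har (by rw [hV₁a]; exact hle₁)
    (by intro l hl; simp [hra l hl, hU l (by simp [hl])])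
    (by intro l hl; simp only [Pi.add_apply, hU l hl]; omega)
    (by rw [hs₁', hr, hV₁a, mul_add]
        have : K ≤ n * K := Nat.le_mul_of_pos_left K hn
        omega) (k - (K + ε)) (by omega)
  simp only [add_assoc, ← Pi.single_add] at hplay₂
  rw [show ε + (K + (k - (K + ε))) = k by omega] at hplay₂
  rw [add_assoc, ← Pi.single_add] at hplay₁
  have hV₂a : V₂ a = M + ε := by rw [heq₂ a har, hV₁a]
  have hplay := (hstep.trans hplay₁).trans hplay₂
  rw [hV₁a] at hle₂
  have hbal : BalancedState r t (M + ε) x (U + Pi.single a k, V₂) := by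
    refine ⟨?_, fun l hl => hle₂ l (by simp [hl]), ⟨b, hbr, ?_⟩, ?_⟩
    · intro l hl
      simp [hra l hl, hU l (by simp [hl])]
    · exact (hle₂ b (by simp [hbr])).antisymm (hV₁b ▸ (le_of_play hplay₂).2 b)
    · dsimp only
      rw [hs₂, hs₁', hr, mul_add]
      omega
  obtain ⟨q, hq, hbq⟩ := hP.exists_play_insert (D := D + (n + 1) * (ε + h)) har hr hbal
    (by simp [hV₂a]) (by simp [hU a has])
    (by dsimp only; rw [hV₂a]; linarith)
  refine ⟨q, hplay.trans hq, ?_⟩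
  rwa [show M + k + (ε + h) = M + ε + k + h by ring]

/-- The second player first raises a strategy that the first player is not using. -/
theorem Passage.overshoot {n : ℕ} (hn : 0 < n) (hP : Passage n (n - 1) 1 0) :
    Passage (n + 1) 0 1 1 := by
  intro N s hs p t M hb
  obtain ⟨a, has, haM⟩ := hb.exists_eq
  obtain ⟨U, V⟩ := p
  obtain ⟨r, har, rfl⟩ : ∃ r, a ∉ r ∧ s = insert a r :=
    ⟨s.erase a, by simp, (Finset.insert_erase has).symm⟩
  have hr : r.card = n := by
    rw [Finset.card_insert_of_notMem har] at hs; omega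
  obtain ⟨b, hbr⟩ := Finset.card_pos.1 (hr ▸ hn)
  have hra : ∀ l ∈ r, l ≠ a := fun l hl h => har (h ▸ hl)
  have hU := hb.fst_eq
  have hV : ∀ l ∈ insert a r, V l = M := by
    refine (Finset.sum_eq_sum_iff_of_le hb.snd_le).1 ?_
    simpa using hb.sum_add
  dsimp only at hU haM
  have hstep : PlayStep (insert a r) (U, V) (U + Pi.single a 1, V + Pi.single b 1) :=
    ⟨a, has, b, by simp [hbr], fun l hl => by simp [hV l hl, haM],
      fun l hl => by simp [hU l hl, hU b (by simp [hbr])], rfl, rfl⟩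
  have hbal : BalancedState r t (M + 1) (n - 1) (U + Pi.single a 1, V + Pi.single b 1) := by
    refine ⟨?_, ?_, ⟨b, hbr, by simp [hV b (by simp [hbr])]⟩, ?_⟩
    · intro l hl
      simp [hra l hl, hU l (by simp [hl])]
    · intro l hl
      by_cases h : l = b
      · subst h; simp [hV l (by simp [hl])]
      · simp [h, hV l (by simp [hl])]
    · simp only [Pi.add_apply, Finset.sum_add_distrib, Finset.sum_pi_single', hbr, if_true]
      rw [Finset.sum_congr rfl fun l hl => hV l (by simp [hl])]
      simp only [Finset.sum_const, hr, smul_eq_mul, mul_add]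
      omega
  obtain ⟨q, hq, hbq⟩ := hP.exists_play_insert (D := n + 1) har hr hbal
    (by simp [(hra b hbr).symm, haM]) (by simp [hU a has])
    (by simp only [Pi.add_apply, haM, Pi.single_eq_of_ne (hra b hbr).symm]; omega)
  refine ⟨q, (ReflTransGen.single hstep).trans hq, ?_⟩
  convert hbq using 1
  ring

theorem Passage.wait {n : ℕ} (hn : 0 < n) (k : ℕ) : Passage n ((n - 1) * k) k 0 := by
  induction n, hn using Nat.le_induction with
  | base => simpa using Passage.one k
  | succ n hn ih =>
    obtain ⟨m, rfl⟩ : ∃ m, n = m + 1 := ⟨n - 1, by omega⟩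
    simp only [Nat.add_sub_cancel] at *
    exact Passage.succ (ε := 0) (h := 0) (by omega) (by omega) ih (by ring) (by simp)

theorem Passage.wait_mul {n : ℕ} (hn : 0 < n) (k m : ℕ) :
    Passage n ((n - 1) * k) (m * k) 0 := by
  induction m with
  | zero => simpa using Passage.zero n _
  | succ m ih =>
    rw [add_mul, one_mul]
    exact ih.trans (h' := 0) (Passage.wait hn k)

theorem Passage.increment {n D k m : ℕ} (hm : 2 ≤ m) (hmn : m ≤ n) (hk : 2 ≤ k)
    (hD : D + m = (n - 1) * k) : Passage n D k 1 := by
  induction n, hmn using Nat.le_induction generalizing D with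
  | base =>
    obtain ⟨r, rfl⟩ : ∃ r, m = r + 2 := ⟨m - 2, by omega⟩
    have h1 : r + 2 - 1 = r + 1 := by omega
    rw [h1] at hD
    refine Passage.succ (n := r + 1) (ε := 1) (h := 0) (x := r * k) (by omega) le_rfl ?_ ?_ ?_
    · exact Passage.wait (by omega) k
    · linarith
    · linarith
  | succ n hn ih =>
    obtain ⟨r, rfl⟩ : ∃ r, n = r + 2 := ⟨n - 2, by omega⟩
    simp only [Nat.add_sub_cancel, show r + 2 - 1 = r + 1 by omega] at *
    have h1 : m ≤ (r + 1) * k := by nlinarith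
    obtain ⟨x, hx⟩ := Nat.exists_eq_add_of_le' h1
    refine Passage.succ (n := r + 2) (ε := 0) (h := 1) (x := x) (by omega) (by omega) (ih hx.symm)
      ?_ ?_
    · linarith
    · linarith

theorem Passage.level {n g x : ℕ} (hn : 2 ≤ n) (hP : Passage (n - 1) 0 (n * g) x) :
    Passage n (n * g) (n * g) x := by
  obtain ⟨r, rfl⟩ : ∃ r, n = r + 2 := ⟨n - 2, by omega⟩
  have := Passage.succ (n := r + 1) (D := (r + 2) * g) (ε := 0) (by omega) (by omega) hP rfl
    (by simpa using Nat.le_mul_of_pos_left ((r + 2) * g) (Nat.succ_pos r))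
  simpa using this

/-- The time at which the level path from the zero state that gains one unit of gap per round
reaches the gap `g`, for `m + 1` strategies. -/
def startTime (m g : ℕ) : ℕ := ∑ r ∈ Finset.range g, (r + 1 + (r + 1) / m)

theorem Passage.increment_one {m g : ℕ} (hm : 0 < m) (hg : 1 ≤ g ∨ m = 1) :
    Passage (m + 1) ((m + 1) * g) (g + 1 + (g + 1) / m) 1 := by
  have h1 := Nat.mod_lt (g + 1) hm
  have h2 := Nat.div_add_mod (g + 1) m
  have h5 : m = 1 → (g + 1) / m = g + 1 := by rintro rfl; simp
  generalize (g + 1) / m = u at *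
  refine Passage.increment (m := m + 1 - (g + 1) % m) (by omega) (by omega) ?_ ?_
  · rcases hg with hg | rfl
    · omega
    · have := h5 rfl
      omega
  · simp only [Nat.add_sub_cancel]
    have h3 : m * (g + 1 + u) = m * g + m + m * u := by ring
    have h4 : (m + 1) * g = m * g + g := by ring
    omega

theorem Passage.exists_increments {m g : ℕ} (hm : 0 < m) (hg : 1 ≤ g) (x : ℕ) :
    ∃ k, k + startTime m g = startTime m (g + x) ∧ Passage (m + 1) ((m + 1) * g) k x := by
  induction x with
  | zero => exact ⟨0, by simp, Passage.zero _ _⟩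
  | succ x ih =>
    obtain ⟨k, hk, hP⟩ := ih
    refine ⟨k + (g + x + 1 + (g + x + 1) / m), ?_, hP.trans ?_⟩
    · have : startTime m (g + (x + 1)) =
          startTime m (g + x) + (g + x + 1 + (g + x + 1) / m) :=
        Finset.sum_range_succ _ _
      omega
    · rw [← mul_add]
      exact Passage.increment_one hm (.inl (by omega))

theorem Passage.startTime {m g : ℕ} (hm : 0 < m) (hg : 1 ≤ g) :
    Passage (m + 1) 0 (startTime m g) g := by
  have h1 : Passage (m + 1) 0 (_root_.startTime m 1) 1 := by
    rcases Nat.eq_or_lt_of_le hm with rfl | hm'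
    · simpa [_root_.startTime] using Passage.increment_one (m := 1) (g := 0) hm (.inr rfl)
    · have : 1 / m = 0 := Nat.div_eq_of_lt hm'
      simpa [_root_.startTime, this] using
        Passage.overshoot hm (by simpa using Passage.wait hm 1)
  obtain ⟨x, rfl⟩ := Nat.exists_eq_add_of_le hg
  obtain ⟨k, hk, hP⟩ := Passage.exists_increments hm le_rfl x
  rw [← hk, add_comm k]
  exact h1.trans (by simpa using hP)

theorem startTime_add {m : ℕ} (hm : 0 < m) (g : ℕ) :
    startTime m (m + g) = startTime m m + startTime m g + (m + 1) * g := by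
  have h : ∀ r, m + r + 1 + (m + r + 1) / m = r + 1 + (r + 1) / m + (m + 1) := by
    intro r
    rw [add_assoc m r 1, Nat.add_div_left _ hm]
    omega
  simp only [startTime, Finset.sum_range_add, h, Finset.sum_add_distrib (g := fun _ => m + 1)]
  simp
  ring

theorem dvd_startTime {m g : ℕ} (hm : 0 < m) (hg : (m + 1) * m ∣ g) :
    m + 1 ∣ startTime m g := by
  obtain ⟨j, rfl⟩ := hg
  have h : ∀ i, startTime m (m * i) ≡ i * startTime m m [MOD (m + 1)] := by
    intro i
    induction i with
    | zero => simp [startTime]; rfl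
    | succ i ih =>
      rw [mul_add, mul_one, add_comm (m * i), startTime_add hm, add_mul i, one_mul,
        add_comm (i * _)]
      have h0 : (m + 1) * (m * i) ≡ 0 [MOD (m + 1)] :=
        (Nat.modEq_zero_iff_dvd).2 (dvd_mul_right _ _)
      simpa using ((Nat.ModEq.refl (startTime m m)).add ih).add h0
  rw [show (m + 1) * m * j = m * ((m + 1) * j) by ring]
  exact (Nat.modEq_zero_iff_dvd).1
    ((h _).trans ((Nat.modEq_zero_iff_dvd).2 (Dvd.intro _ (mul_assoc (m + 1) j _).symm)))

theorem startTime_mono (m : ℕ) : Monotone (startTime m) :=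
  fun _ _ h => Finset.sum_le_sum_of_subset (Finset.range_mono h)

/-- A step width `y`, of order `h ^ (m / (m + 1))`, by which the gap `h - y` can be raised to `h`
in one level round on `m + 2` strategies. -/
theorem exists_stepWidth {m : ℕ} (hm : 0 < m) {K : ℝ} (hK : 0 < K) (A : ℕ) {M : ℕ}
    (hM : 0 < M) :
    ∃ L : ℝ, 0 < L ∧ ∃ H : ℕ, ∀ h : ℕ, H ≤ h → ∃ y : ℕ, 2 * y ≤ h ∧ 1 ≤ y ∧ A ≤ y ∧
      M ∣ h - y ∧ K * (y : ℝ) ^ (((m : ℝ) + 1) / m) ≤ (m + 2) * ((h : ℝ) - y) ∧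
      ((m : ℝ) + 2) * h ≤ L * (y * (h : ℝ) ^ (1 / ((m : ℝ) + 1))) := by
  have hm0 : (0 : ℝ) < m := by exact_mod_cast hm
  set γ : ℝ := m / (m + 1) with hγ
  have hγ0 : 0 < γ := by positivity
  have hγ1 : γ + 1 / ((m : ℝ) + 1) = 1 := by rw [hγ]; field_simp
  have hγβ : γ * (((m : ℝ) + 1) / m) = 1 := by rw [hγ]; field_simp
  set η : ℝ := (1 / (K + 1)) ^ γ with hη
  have hη0 : 0 < η := by positivity
  have hη1 : η ≤ 1 := Real.rpow_le_one (by positivity)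
    (by rw [div_le_one (by positivity)]; linarith) hγ0.le
  have hηβ : η ^ (((m : ℝ) + 1) / m) = 1 / (K + 1) := by
    rw [hη, ← Real.rpow_mul (by positivity), hγβ, Real.rpow_one]
  refine ⟨2 * (m + 2) / η, by positivity, ?_⟩
  have t1 : Filter.Tendsto (fun h : ℕ => η / 2 * (h : ℝ) ^ γ) Filter.atTop Filter.atTop :=
    ((tendsto_rpow_atTop hγ0).comp tendsto_natCast_atTop_atTop).const_mul_atTop (by positivity)
  have t2 : Filter.Tendsto (fun h : ℕ => (h : ℝ) ^ (1 / ((m : ℝ) + 1)))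
      Filter.atTop Filter.atTop :=
    (tendsto_rpow_atTop (by positivity)).comp tendsto_natCast_atTop_atTop
  obtain ⟨H, hH⟩ := Filter.eventually_atTop.1
    ((t1.eventually_ge_atTop (A + M + 2 : ℝ)).and (t2.eventually_ge_atTop 2))
  refine ⟨H + 1, fun h hh => ?_⟩
  obtain ⟨h1, h2⟩ := hH h (by omega)
  have hpos : (0 : ℝ) < h := by exact_mod_cast (by omega : 0 < h)
  have hsplit : (h : ℝ) ^ γ * (h : ℝ) ^ (1 / ((m : ℝ) + 1)) = h := by
    rw [← Real.rpow_add hpos, hγ1, Real.rpow_one]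
  have hγpos : 0 < (h : ℝ) ^ γ := by positivity
  have h3 : 2 * (h : ℝ) ^ γ ≤ h := by nlinarith
  set c : ℕ := ⌈η / 2 * (h : ℝ) ^ γ⌉₊ + A with hc
  have hc1 : η / 2 * (h : ℝ) ^ γ + A ≤ c := by
    rw [hc]; push_cast; gcongr; exact Nat.le_ceil _
  have hc2 : (c : ℝ) ≤ η / 2 * (h : ℝ) ^ γ + 1 + A := by
    rw [hc]; push_cast; gcongr; exact (Nat.ceil_lt_add_one (by positivity)).le
  have hηh : η * (h : ℝ) ^ γ ≤ (h : ℝ) ^ γ := mul_le_of_le_one_left hγpos.le hη1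
  have hmod : (((h - c) % M : ℕ) : ℝ) ≤ M := by exact_mod_cast (Nat.mod_lt _ hM).le
  set y : ℕ := c + (h - c) % M with hy
  have hy1 : (y : ℝ) ≤ η * (h : ℝ) ^ γ := by
    rw [hy]; push_cast; linarith
  have hy0 : η / 2 * (h : ℝ) ^ γ + A ≤ y := by
    rw [hy]; push_cast
    have : (0 : ℝ) ≤ (((h - c) % M : ℕ) : ℝ) := by positivity
    linarith
  have hyh : 2 * (y : ℝ) ≤ h := by linarith
  have hA : (0 : ℝ) ≤ A := by positivity
  have hM' : (0 : ℝ) ≤ M := by positivity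
  refine ⟨y, by exact_mod_cast hyh, ?_, ?_, ?_, ?_, ?_⟩
  · have : (1 : ℝ) ≤ y := by linarith
    exact_mod_cast this
  · have : (A : ℝ) ≤ y := by linarith
    exact_mod_cast this
  · rw [hy, ← Nat.sub_sub]
    exact Nat.dvd_sub_mod _
  · calc K * (y : ℝ) ^ (((m : ℝ) + 1) / m)
        ≤ K * (η * (h : ℝ) ^ γ) ^ (((m : ℝ) + 1) / m) := by gcongr
      _ = K / (K + 1) * h := by
        rw [Real.mul_rpow hη0.le hγpos.le, hηβ, ← Real.rpow_mul hpos.le, hγβ, Real.rpow_one]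
        ring
      _ ≤ 1 * h := by
        gcongr
        rw [div_le_one (by positivity)]; linarith
      _ ≤ (m + 2) * ((h : ℝ) - y) := by nlinarith
  · calc ((m : ℝ) + 2) * h
        = 2 * (m + 2) / η * (η / 2 * (h : ℝ) ^ γ * (h : ℝ) ^ (1 / ((m : ℝ) + 1))) := by
          rw [mul_assoc (η / 2), hsplit]; field_simp
      _ ≤ _ := by gcongr; linarith

/-- On `m + 1` strategies, raising the gap from a fixed value to a large `h` takes at most
`K * h ^ ((m + 1) / m)` rounds, with the number of rounds in a prescribed residue class. -/
def ClimbBound (m : ℕ) (K : ℝ) : Prop :=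
  ∀ g : ℕ, 1 ≤ g → ∃ F : ℕ, ∀ x : ℕ, F ≤ g + x → ∃ k : ℕ,
    (k : ℝ) ≤ K * ((g + x : ℕ) : ℝ) ^ (((m : ℝ) + 1) / m) ∧
    m + 1 ∣ k + startTime m g ∧ Passage (m + 1) ((m + 1) * g) k x

theorem climbBound_one : ClimbBound 1 2 := by
  intro g hg
  refine ⟨0, fun x _ => ?_⟩
  obtain ⟨k, hk, hP⟩ := Passage.exists_increments one_pos hg x
  refine ⟨k, ?_, hk ▸ Finset.dvd_sum fun r _ => ⟨r + 1, by simp; ring⟩, hP⟩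
  have h1 : k ≤ (g + x) * (2 * (g + x)) := by
    refine le_trans (by omega : k ≤ startTime 1 (g + x)) ?_
    have := Finset.sum_le_card_nsmul (Finset.range (g + x)) (fun r => r + 1 + (r + 1) / 1)
      (2 * (g + x)) (fun r hr => by rw [Finset.mem_range] at hr; simp; omega)
    simpa [startTime] using this
  have h2 : (((1 : ℕ) : ℝ) + 1) / (1 : ℕ) = (2 : ℕ) := by norm_num
  rw [h2, Real.rpow_natCast]
  exact_mod_cast h1.trans_eq (by ring)

theorem le_rpow_climb {m : ℕ} (hm : 0 < m) (h : ℕ) :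
    (h : ℝ) ≤ (h : ℝ) ^ (((m : ℝ) + 1) / m) := by
  have hm0 : (0 : ℝ) < m := by exact_mod_cast hm
  rcases Nat.eq_zero_or_pos h with rfl | hh
  · simpa using Real.rpow_nonneg le_rfl _
  · refine Real.self_le_rpow_of_one_le (by exact_mod_cast hh) ?_
    rw [one_le_div hm0]; linarith

theorem ClimbBound.passage {m : ℕ} (hm : 0 < m) {K : ℝ} (hC : ClimbBound m K) :
    ∃ F : ℕ, ∀ h : ℕ, F ≤ h → ∀ S : ℕ, m + 1 ∣ S →
      (K + 1) * (h : ℝ) ^ (((m : ℝ) + 1) / m) ≤ S → Passage (m + 1) 0 S h := by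
  obtain ⟨F, hF⟩ := hC m hm
  refine ⟨F + m + startTime m m, fun h hh S hS hKS => ?_⟩
  obtain ⟨x, rfl⟩ := Nat.exists_eq_add_of_le (by omega : m ≤ h)
  obtain ⟨k, hk, hdvd, hP⟩ := hF x (by omega)
  have h1 : k + startTime m m ≤ S := by
    have h2 := le_rpow_climb hm (m + x)
    have h3 : (startTime m m : ℝ) ≤ ((m + x : ℕ) : ℝ) := by
      exact_mod_cast (by omega : startTime m m ≤ m + x)
    have : ((k + startTime m m : ℕ) : ℝ) ≤ S := by push_cast at *; linarith
    exact_mod_cast this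
  obtain ⟨j, hj⟩ := (Nat.dvd_sub hS hdvd)
  have hw : Passage (m + 1) ((m + 1) * m) (j * (m + 1)) 0 := by
    simpa [mul_comm] using Passage.wait_mul (Nat.succ_pos m) (m + 1) j
  have h4 := ((Passage.startTime hm hm).trans (h' := 0) (by simpa using hw)).trans
    (k' := k) (h' := x) (by simpa using hP)
  rw [mul_comm j, ← hj] at h4
  convert h4 using 1 <;> omega

theorem ClimbBound.succ {m : ℕ} (hm : 0 < m) {K : ℝ} (hK : 0 < K) (hC : ClimbBound m K) :
    ∃ K', 0 < K' ∧ ClimbBound (m + 1) K' := by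
  obtain ⟨A, hA⟩ := hC.passage hm
  obtain ⟨L, hL, H, hH⟩ := exists_stepWidth (K := K + 1) hm (by positivity) A
    (M := (m + 1 + 1) * (m + 1)) (by positivity)
  have hm0 : (0 : ℝ) < m := by exact_mod_cast hm
  set β : ℝ := (((m + 1 : ℕ) : ℝ) + 1) / (m + 1 : ℕ) with hβ
  have hβ1 : β = 1 + 1 / ((m : ℝ) + 1) := by rw [hβ]; push_cast; field_simp
  refine ⟨L + 1, by positivity, fun g hg => ?_⟩
  set B := 2 * g + H with hB
  have key : ∀ x : ℕ, ((m + 1 + 1) * (m + 1) ∣ g + x ∨ B ≤ g + x) → ∃ k : ℕ,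
      (k : ℝ) ≤ startTime (m + 1) B + L * ((g + x : ℕ) : ℝ) ^ β ∧
      m + 1 + 1 ∣ k + startTime (m + 1) g ∧
      Passage (m + 1 + 1) ((m + 1 + 1) * g) k x := by
    intro x
    induction x using Nat.strong_induction_on with
    | _ x ih =>
      intro hx
      by_cases hlt : g + x < B
      · have hd := hx.resolve_right (by omega)
        obtain ⟨k, hk, hP⟩ := Passage.exists_increments (m := m + 1) (by omega) hg x
        refine ⟨k, ?_, hk ▸ dvd_startTime (Nat.succ_pos m) hd, hP⟩
        have h1 : (k : ℝ) ≤ startTime (m + 1) B := by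
          have := startTime_mono (m + 1) hlt.le
          exact_mod_cast (by omega : k ≤ startTime (m + 1) B)
        have h2 : 0 ≤ L * ((g + x : ℕ) : ℝ) ^ β := by positivity
        linarith
      · obtain ⟨y, hy2, hy1, hAy, hdvd, hKy, hLy⟩ := hH (g + x) (by omega)
        obtain ⟨z, rfl⟩ := Nat.exists_eq_add_of_le' (by omega : y ≤ x)
        rw [← add_assoc, Nat.add_sub_cancel] at hdvd
        rw [← add_assoc] at hKy hLy
        obtain ⟨k, hk, hkd, hP⟩ := ih z (by omega) (.inl hdvd)
        have hsub : Passage (m + 1) 0 ((m + 1 + 1) * (g + z)) y := by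
          refine hA y hAy _ (((dvd_mul_left _ _).trans hdvd).mul_left _) (hKy.trans_eq ?_)
          push_cast
          ring
        refine ⟨k + (m + 1 + 1) * (g + z), ?_, ?_, hP.trans (h' := y) ?_⟩
        · rw [← add_assoc]
          have hpos : (0 : ℝ) < ((g + z + y : ℕ) : ℝ) := by exact_mod_cast (by omega)
          have hpos' : (0 : ℝ) < ((g + z : ℕ) : ℝ) := by exact_mod_cast (by omega)
          have e1 : ((g + z + y : ℕ) : ℝ) ^ β =
              ((g + z + y : ℕ) : ℝ) * ((g + z + y : ℕ) : ℝ) ^ (1 / ((m : ℝ) + 1)) := by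
            rw [hβ1, Real.rpow_add hpos, Real.rpow_one]
          have e2 : ((g + z : ℕ) : ℝ) ^ β ≤
              ((g + z : ℕ) : ℝ) * ((g + z + y : ℕ) : ℝ) ^ (1 / ((m : ℝ) + 1)) := by
            rw [hβ1, Real.rpow_add hpos', Real.rpow_one]
            gcongr ?_ * ?_
            exact Real.rpow_le_rpow hpos'.le (by exact_mod_cast Nat.le_add_right _ y)
              (by positivity)
          have e3 := mul_le_mul_of_nonneg_left e2 hL.le
          have e4 : (0 : ℝ) ≤ ((m : ℝ) + 2) * y := by positivity
          rw [e1]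
          generalize ((g + z + y : ℕ) : ℝ) ^ (1 / ((m : ℝ) + 1)) = w at *
          push_cast at *
          linarith
        · rw [add_right_comm k]
          exact hkd.add (dvd_mul_right (m + 1 + 1) (g + z))
        · rw [← mul_add]
          exact Passage.level (by omega) hsub
  refine ⟨B + startTime (m + 1) B, fun x hx => ?_⟩
  obtain ⟨k, hk, h⟩ := key x (.inr (by omega))
  refine ⟨k, ?_, h⟩
  have h1 : (startTime (m + 1) B : ℝ) ≤ ((g + x : ℕ) : ℝ) := by
    exact_mod_cast (by omega : startTime (m + 1) B ≤ g + x)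
  have h2 := le_rpow_climb (Nat.succ_pos m) (g + x)
  rw [← hβ] at h2 ⊢
  linarith

theorem exists_climbBound {m : ℕ} (hm : 0 < m) : ∃ K, 0 < K ∧ ClimbBound m K := by
  induction m, hm using Nat.le_induction with
  | base => exact ⟨2, two_pos, climbBound_one⟩
  | succ m hm ih =>
    obtain ⟨K, hK, hC⟩ := ih
    exact hC.succ hm hK

/-- A relation in which every good point leads to a good point has an infinite path that
visits good points infinitely often. -/
theorem exists_path_frequently {α : Type*} {r : α → α → Prop} {good : α → Prop} {a : α}
    (ha : good a) (h : ∀ p, good p → ∃ q, good q ∧ TransGen r p q) :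
    ∃ f : ℕ → α, f 0 = a ∧ (∀ t, r (f t) (f (t + 1))) ∧ ∀ t, ∃ t' ≥ t, good (f t') := by
  let R : ℕ → α → Prop := fun k => Nat.rec good (fun _ P p => ∃ p', r p p' ∧ P p') k
  have hR : ∀ p, good p → ∃ k, R (k + 1) p := by
    intro p hp
    obtain ⟨q, hq, hpq⟩ := h p hp
    clear hp
    induction hpq using TransGen.head_induction_on with
    | single hr => exact ⟨0, q, hr, hq⟩
    | head hr _ ih =>
      obtain ⟨k, hk⟩ := ih
      exact ⟨k + 1, _, hr, hk⟩
  classical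
  let d : α → ℕ := fun p => sInf {k | R (k + 1) p}
  have hnext : ∀ p : {p // ∃ k, R (k + 1) p}, ∃ p' : {p // ∃ k, R (k + 1) p},
      r p p' ∧ (good p' ∨ d p' < d p) := by
    rintro ⟨p, hp⟩
    obtain ⟨p', hr, hp'⟩ : R (d p + 1) p := Nat.sInf_mem hp
    rcases hd : d p with _ | k
    · rw [hd] at hp'
      exact ⟨⟨p', hR p' hp'⟩, hr, .inl hp'⟩
    · rw [hd] at hp'
      refine ⟨⟨p', k, hp'⟩, hr, .inr ?_⟩
      have : d p' ≤ k := Nat.sInf_le hp'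
      dsimp only
      omega
  choose next hnext1 hnext2 using hnext
  let f : ℕ → {p // ∃ k, R (k + 1) p} := fun t => Nat.rec ⟨a, hR a ha⟩ (fun _ p => next p) t
  refine ⟨fun t => (f t).1, rfl, fun t => hnext1 (f t), ?_⟩
  have key : ∀ n t, d (f t).1 < n → ∃ t' ≥ t, good (f t').1 := by
    intro n
    induction n with
    | zero => intro t ht; omega
    | succ n ih =>
      intro t ht
      rcases hnext2 (f t) with hg | hlt
      · exact ⟨t + 1, by omega, hg⟩
      · obtain ⟨t', ht', hg⟩ := ih (t + 1) (lt_of_lt_of_le hlt (by omega))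
        exact ⟨t', by omega, hg⟩
  exact fun t => key _ t (Nat.lt_succ_self _)

/-- From every balanced state one can reach a balanced state in which the number of rounds is
comparable to the power `(m + 1) / m` of the gap. -/
theorem ClimbBound.exists_passage {m : ℕ} (hm : 0 < m) {K : ℝ} (hC : ClimbBound m K)
    (T g : ℕ) : ∃ k x : ℕ, 0 < k ∧ Passage (m + 1) ((m + 1) * g) k x ∧
      ((g + x : ℕ) : ℝ) ^ (((m : ℝ) + 1) / m) ≤ (T + k : ℕ) ∧
      ((T + k : ℕ) : ℝ) ≤ (K + 4) * ((g + x : ℕ) : ℝ) ^ (((m : ℝ) + 1) / m) := by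
  have hm0 : (0 : ℝ) < m := by exact_mod_cast hm
  wlog hg : 1 ≤ g generalizing T g
  · obtain rfl : g = 0 := by omega
    obtain ⟨k, x, hk, hP, h1, h2⟩ := this (T + startTime m 1) 1 le_rfl
    refine ⟨startTime m 1 + k, 1 + x, by omega,
      (Passage.startTime hm le_rfl).trans (by simpa using hP), ?_, ?_⟩
    · simpa [add_assoc] using h1
    · simpa [add_assoc] using h2
  obtain ⟨F, hF⟩ := hC g hg
  obtain ⟨q, hq⟩ : ∃ q, q = F + T + g := ⟨_, rfl⟩
  have hqm : q ≤ m * q := Nat.le_mul_of_pos_left q hm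
  obtain ⟨x, hx⟩ := Nat.exists_eq_add_of_le (by omega : g ≤ m * q)
  obtain ⟨k, hk, -, hP⟩ := hF x (by omega)
  have hle := le_rpow_climb hm (g + x)
  set Y : ℝ := ((g + x : ℕ) : ℝ) ^ (((m : ℝ) + 1) / m) with hY
  have hx1 : (1 : ℝ) ≤ ((g + x : ℕ) : ℝ) := by exact_mod_cast (by omega)
  have hT : (T : ℝ) ≤ ((g + x : ℕ) : ℝ) := by exact_mod_cast (by omega)
  have hw0 : 0 < (m + 1) * q := Nat.mul_pos (by omega) (by omega)
  have hw : (((m + 1) * q : ℕ) : ℝ) ≤ 2 * ((g + x : ℕ) : ℝ) := by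
    rw [← hx]
    exact_mod_cast (by linarith : (m + 1) * q ≤ 2 * (m * q))
  have hwait : Passage (m + 1) (m * ((m + 1) * q))
      (⌈Y / ((m + 1) * q : ℕ)⌉₊ * ((m + 1) * q)) 0 := by
    simpa using Passage.wait_mul (Nat.succ_pos m) ((m + 1) * q) ⌈Y / ((m + 1) * q : ℕ)⌉₊
  have hj1 : Y ≤ (⌈Y / ((m + 1) * q : ℕ)⌉₊ * ((m + 1) * q) : ℕ) := by
    rw [Nat.cast_mul, ← div_le_iff₀ (by exact_mod_cast hw0)]
    exact Nat.le_ceil _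
  have hj2 : ((⌈Y / ((m + 1) * q : ℕ)⌉₊ * ((m + 1) * q) : ℕ) : ℝ) ≤ Y + ((m + 1) * q : ℕ) := by
    have h0 : (0 : ℝ) < ((m + 1) * q : ℕ) := by exact_mod_cast hw0
    rw [Nat.cast_mul]
    calc _ ≤ (Y / ((m + 1) * q : ℕ) + 1) * ((m + 1) * q : ℕ) := by
          gcongr
          exact (Nat.ceil_lt_add_one (by positivity)).le
      _ = _ := by field_simp
  generalize ⌈Y / ((m + 1) * q : ℕ)⌉₊ * ((m + 1) * q) = J at *
  refine ⟨k + J, x, ?_, hP.trans (h' := 0) ?_, ?_, ?_⟩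
  · have : (0 : ℝ) < J := by linarith
    have : 0 < J := by exact_mod_cast this
    omega
  · rw [← mul_add, ← hx]
    convert hwait using 1
    ring
  · rw [Nat.cast_add T, Nat.cast_add k]
    linarith [T.cast_nonneg (α := ℝ), k.cast_nonneg (α := ℝ)]
  · rw [Nat.cast_add T, Nat.cast_add k]
    linarith

theorem BalancedState.gap_eq {n t g D : ℕ} {U V : ℕ → Fin n → ℕ} {i : ℕ}
    (hb : BalancedState Finset.univ t (t + g) D (U i, V i)) : gap n U V i = g := by
  obtain ⟨a, -, ha⟩ := hb.exists_eq
  have : Nonempty (Fin n) := ⟨a⟩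
  have h1 : ⨆ l, V i l = t + g :=
    le_antisymm (ciSup_le fun l => hb.snd_le l (by simp))
      (ha ▸ le_ciSup (Set.finite_range (V i)).bddAbove a)
  have h2 : ⨅ l, U i l = t := by
    rw [iInf_congr fun l => hb.fst_eq l (by simp), ciInf_const]
  rw [gap, h1, h2]
  push_cast
  ring

/-- For every `n ≥ 2` there exist a dynamic `(U, V)` for `Iₙ` and constants
`C ≥ c > 0` such that infinitely many `T` satisfy both `U(nT) = (T, …, T)` and
`c·T^((n−1)/n) ≤ gap(nT) ≤ C·T^((n−1)/n)`. -/
theorem stmt_3 :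
    ∀ n : ℕ, 2 ≤ n →
      ∃ U V : ℕ → Fin n → ℕ, IsDynamic n U V ∧
        ∃ c C : ℝ, 0 < c ∧ c ≤ C ∧
          {T : ℕ |
            (∀ l, U (n * T) l = T) ∧
            c * (T : ℝ) ^ (((n : ℝ) - 1) / n) ≤ (gap n U V (n * T) : ℝ) ∧
            (gap n U V (n * T) : ℝ) ≤ C * (T : ℝ) ^ (((n : ℝ) - 1) / n)}.Infinite := by
  intro n hn
  obtain ⟨m, rfl⟩ : ∃ m, n = m + 1 := ⟨n - 1, by omega⟩
  have hm : 0 < m := by omega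
  have hm0 : (0 : ℝ) < m := by exact_mod_cast hm
  obtain ⟨K, hK, hC⟩ := exists_climbBound hm
  set α : ℝ := (((m + 1 : ℕ) : ℝ) - 1) / (m + 1 : ℕ) with hα
  have hα0 : 0 < α := by rw [hα]; push_cast; simp; positivity
  have hβα : (((m : ℝ) + 1) / m) * α = 1 := by rw [hα]; push_cast; field_simp; ring
  let good : (Fin (m + 1) → ℕ) × (Fin (m + 1) → ℕ) → Prop := fun p => ∃ T g : ℕ,
    BalancedState Finset.univ T (T + g) ((m + 1) * g) p ∧
      (g : ℝ) ^ (((m : ℝ) + 1) / m) ≤ T ∧ (T : ℝ) ≤ (K + 4) * (g : ℝ) ^ (((m : ℝ) + 1) / m)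
  have hzero : good 0 := by
    have : ((0 : ℕ) : ℝ) ^ (((m : ℝ) + 1) / m) = 0 := by
      rw [Nat.cast_zero, Real.zero_rpow (by positivity)]
    refine ⟨0, 0, ⟨by simp, by simp, ⟨0, by simp⟩, by simp⟩, ?_, ?_⟩ <;> rw [this] <;> simp
  obtain ⟨f, hf0, hf, hgood⟩ := exists_path_frequently (r := PlayStep Finset.univ) hzero (by
    rintro p ⟨T, g, hb, -, -⟩
    obtain ⟨k, x, hk, hP, h1, h2⟩ := hC.exists_passage hm T g
    obtain ⟨q, hq, hbq⟩ := hP _ _ (by simp) p _ _ hb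
    refine ⟨q, ⟨T + k, g + x, ?_, h1, h2⟩, ?_⟩
    · convert hbq using 1 <;> ring
    · refine (reflTransGen_iff_eq_or_transGen.1 hq).resolve_left ?_
      rintro rfl
      have e1 := hb.fst_eq 0 (by simp)
      have e2 := hbq.fst_eq 0 (by simp)
      omega)
  have hsum : ∀ t, ∑ l, (f t).1 l = t := by
    intro t
    induction t with
    | zero => simp [hf0]
    | succ t ih => rw [sum_fst_of_playStep (hf t), ih]
  refine ⟨fun t => (f t).1, fun t => (f t).2, ⟨by simp [hf0], by simp [hf0], fun t => ?_⟩,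
    ((K + 4) ^ α)⁻¹, 1, by positivity, ?_, ?_⟩
  · obtain ⟨i, -, j, -, hmax, hmin, h1, h2⟩ := hf t
    exact ⟨i, j, fun l => hmax l (by simp), fun l => hmin l (by simp),
      fun l => by simp [h1, Pi.single_apply], fun l => by simp [h2, Pi.single_apply]⟩
  · exact inv_le_one_of_one_le₀ (Real.one_le_rpow (by linarith) hα0.le)
  · refine Set.infinite_of_forall_exists_gt fun B => ?_
    obtain ⟨t, ht, T, g, hb, h1, h2⟩ := hgood ((m + 1) * (B + 1))
    have htT : (m + 1) * T = t := by
      rw [← hsum t, Finset.sum_congr rfl hb.fst_eq]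
      simp
    subst htT
    have hpow : ((g : ℝ) ^ (((m : ℝ) + 1) / m)) ^ α = g := by
      rw [← Real.rpow_mul (by positivity), hβα, Real.rpow_one]
    have hgap := BalancedState.gap_eq (U := fun t => (f t).1) (V := fun t => (f t).2) hb
    refine ⟨T, ⟨fun l => hb.fst_eq l (by simp), ?_, ?_⟩,
      Nat.lt_of_succ_le (Nat.le_of_mul_le_mul_left ht (Nat.succ_pos m))⟩
    · rw [hgap, inv_mul_le_iff₀ (by positivity), Int.cast_natCast, ← hpow,
        ← Real.mul_rpow (by positivity) (by positivity)]
      exact Real.rpow_le_rpow (by positivity) h2 hα0.le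
    · rw [hgap, one_mul, Int.cast_natCast]
      conv_lhs => rw [← hpow]
      exact Real.rpow_le_rpow (by positivity) h1 hα0.le
end
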